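/- arXiv:1904.10244 — 2 statements merged into one kernel-verified Lean document; each statement's English description precedes it below -/
import Mathlib

section
/- For each n ≥ 1 let i_n denote the number of pairs (F, J) where F is an acyclic simple graph (forest) on the vertex set Fin n and J is a maximal independent set of F, and let f_n denote the number of acyclic simple graphs on Fin n. Then the sequence (i_n / f_n)^{1/n} converges as n → ∞ to a limit α satisfying 1.27386 < α < 1.27387. -/
open Filter Topology MeasureTheory

/-- `J` is an independent set of the simple graph `G`. -/
def IsIndepSet {V : Type*} (G : SimpleGraph V) (J : Set V) : Prop :=
  ∀ ⦃u v : V⦄, u ∈ J → v ∈ J → ¬ G.Adj u v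

/-- `J` is a maximal independent set of `G`. -/
def IsMaximalIndepSet {V : Type*} (G : SimpleGraph V) (J : Set V) : Prop :=
  IsIndepSet G J ∧ ∀ J' : Set V, IsIndepSet G J' → ¬ J ⊂ J'

/-- The pairs `(F, J)` where `F` is a forest (acyclic simple graph) on `Fin n`
and `J` is a maximal independent set of `F`. -/
def MISpace (n : ℕ) :=
  {p : SimpleGraph (Fin n) × Set (Fin n) // p.1.IsAcyclic ∧ IsMaximalIndepSet p.1 p.2}

/-- `iN n` is the number of pairs `(F, J)` where `F` is a forest on `Fin n`
and `J` is a maximal independent set of `F`. -/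
noncomputable def iN (n : ℕ) : ℕ := Nat.card (MISpace n)

/-- `fN n` is the number of forests (acyclic simple graphs) on `Fin n`. -/
noncomputable def fN (n : ℕ) : ℕ := Nat.card {G : SimpleGraph (Fin n) // G.IsAcyclic}

/-- Kinds of rooted trees: `any` carries no vertex set; in the other kinds a vertex set `J` that is
independent and dominates all non-root vertices is marked, and the root is in `J` (`mem`), outside
`J` with a neighbour in `J` (`dom`), or outside `J` without one (`undom`). -/
inductive TreeKind
  | any
  | mem
  | dom
  | undom

instance : DecidableEq TreeKind := fun a b => by
  cases a <;> cases b <;> first | exact isTrue rfl | exact isFalse nofun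

instance : Fintype TreeKind := ⟨{.any, .mem, .dom, .undom}, fun k => by cases k <;> simp⟩

/-- The kind obtained by hanging the root of a tree of the second kind below the root of a tree of
the first kind, or `none` if the result would have no kind. -/
def TreeKind.glue : TreeKind → TreeKind → Option TreeKind
  | any, any => some any
  | mem, dom => some mem
  | mem, undom => some mem
  | dom, dom => some dom
  | dom, mem => some dom
  | undom, mem => some dom
  | undom, dom => some undom
  | _, _ => none

/-- The condition that a kind of marked rooted tree puts on its root. -/
def TreeKind.RootCond {V : Type*} (G : SimpleGraph V) (r : V) (J : Set V) : TreeKind → Prop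
  | any => False
  | mem => r ∈ J
  | dom => r ∉ J ∧ ∃ u ∈ J, G.Adj r u
  | undom => r ∉ J ∧ ∀ u ∈ J, ¬ G.Adj r u

/-- `G` is a tree on the vertex set `S` with root `r`, all vertices outside `S` being isolated. -/
structure IsTreeOn {V : Type*} (S : Set V) (G : SimpleGraph V) (r : V) : Prop where
  root_mem : r ∈ S
  adj_mem : ∀ {u v}, G.Adj u v → u ∈ S
  reachable : ∀ v ∈ S, G.Reachable r v
  acyclic : G.IsAcyclic

/-- `J ⊆ S` is independent and dominates every vertex of `S` except possibly `r`. -/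
structure IsNearMIS {V : Type*} (S : Set V) (G : SimpleGraph V) (r : V) (J : Set V) : Prop where
  subset : J ⊆ S
  indep : ∀ u ∈ J, ∀ v ∈ J, ¬ G.Adj u v
  dominated : ∀ v ∈ S, v ∉ J → v ≠ r → ∃ u ∈ J, G.Adj v u

/-- The triple `t = (G, r, J)` is a rooted tree of kind `k` on the vertex set `S`. -/
def IsRootedTree {V : Type*} (k : TreeKind) (S : Set V) (t : SimpleGraph V × V × Set V) : Prop :=
  IsTreeOn S t.1 t.2.1 ∧ (k = .any ∧ t.2.2 = ∅ ∨ IsNearMIS S t.1 t.2.1 t.2.2 ∧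
    k.RootCond t.1 t.2.1 t.2.2)

/-- Join the roots of `s` and `t` by an edge, keeping the root of `s`. -/
def glueTrees {V : Type*} (s t : SimpleGraph V × V × Set V) : SimpleGraph V × V × Set V :=
  (s.1 ⊔ t.1 ⊔ SimpleGraph.edge s.2.1 t.2.1, s.2.1, s.2.2 ∪ t.2.2)

section
variable {V : Type*}

lemma SimpleGraph.Reachable.mem_of_closed {G : SimpleGraph V} {S : Set V} {u v : V}
    (h : G.Reachable u v) (hS : ∀ a ∈ S, ∀ b, G.Adj a b → b ∈ S) (hu : u ∈ S) : v ∈ S := by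
  obtain ⟨p⟩ := h
  induction p with
  | nil => exact hu
  | cons hab _ ih => exact ih (hS _ hu _ hab)

lemma SimpleGraph.Walk.edges_subset_left {G H : SimpleGraph V} {S T : Set V}
    (hST : Disjoint S T) (hG : ∀ {u v}, G.Adj u v → u ∈ S) (hH : ∀ {u v}, H.Adj u v → u ∈ T)
    {u v : V} (p : (G ⊔ H).Walk u v) (hu : u ∈ S) : ∀ e ∈ p.edges, e ∈ G.edgeSet := by
  induction p with
  | nil => simp
  | cons hab q ih =>
    have hG' : G.Adj _ _ := hab.resolve_right fun h => Set.disjoint_left.1 hST hu (hH h)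
    intro e he
    rw [SimpleGraph.Walk.edges_cons, List.mem_cons] at he
    rcases he with rfl | he
    · exact hG'
    · exact ih (hG hG'.symm) e he

lemma SimpleGraph.IsAcyclic.sup_of_disjoint {G H : SimpleGraph V} {S T : Set V}
    (hST : Disjoint S T) (hG : ∀ {u v}, G.Adj u v → u ∈ S) (hH : ∀ {u v}, H.Adj u v → u ∈ T)
    (hGa : G.IsAcyclic) (hHa : H.IsAcyclic) : (G ⊔ H).IsAcyclic := by
  have key : ∀ {G H : SimpleGraph V} {S T : Set V} (_ : Disjoint S T)
      (_ : ∀ {u v}, G.Adj u v → u ∈ S) (_ : ∀ {u v}, H.Adj u v → u ∈ T) (_ : G.IsAcyclic)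
      (v : V) (c : (G ⊔ H).Walk v v), v ∈ S → ¬ c.IsCycle := by
    intro G H S T hST hG hH hGa v c hv hc
    exact hGa _ (hc.transfer (c.edges_subset_left hST hG hH hv))
  intro v c hc
  rcases c.adj_snd hc.not_nil with h | h
  · exact key hST hG hH hGa v c (hG h) hc
  · have hv := hH h
    clear h
    revert c
    rw [sup_comm]
    intro c hc
    exact key hST.symm hH hG hHa v c hv hc

lemma IsTreeOn.glue {S T : Set V} {G H : SimpleGraph V} {r r' : V} (hST : Disjoint S T)
    (hG : IsTreeOn S G r) (hH : IsTreeOn T H r') :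
    IsTreeOn (S ∪ T) (G ⊔ H ⊔ SimpleGraph.edge r r') r := by
  have hne : r ≠ r' := fun h => Set.disjoint_left.1 hST hG.root_mem (h ▸ hH.root_mem)
  have hr : (G ⊔ H ⊔ SimpleGraph.edge r r').Adj r r' :=
    Or.inr (by simp [SimpleGraph.edge_adj, hne])
  refine ⟨Or.inl hG.root_mem, ?_, ?_, ?_⟩
  · rintro u v ((h | h) | h)
    · exact Or.inl (hG.adj_mem h)
    · exact Or.inr (hH.adj_mem h)
    · rw [SimpleGraph.edge_adj] at h
      rcases h.1 with ⟨rfl, -⟩ | ⟨rfl, -⟩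
      · exact Or.inl hG.root_mem
      · exact Or.inr hH.root_mem
  · rintro v (hv | hv)
    · exact (hG.reachable v hv).mono (le_sup_left.trans le_sup_left)
    · exact hr.reachable.trans ((hH.reachable v hv).mono (le_sup_right.trans le_sup_left))
  · refine SimpleGraph.IsAcyclic.sup_edge_of_not_reachable (fun h => ?_)
      (hG.acyclic.sup_of_disjoint hST hG.adj_mem hH.adj_mem hH.acyclic)
    refine Set.disjoint_left.1 hST (h.mem_of_closed (S := S) ?_ hG.root_mem) hH.root_mem
    rintro a ha b (h | h)
    · exact hG.adj_mem h.symm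
    · exact absurd (hH.adj_mem h) (Set.disjoint_left.1 hST ha)

lemma glue_adj_left {S T : Set V} {G H : SimpleGraph V} {r r' u v : V} (hST : Disjoint S T)
    (hH : IsTreeOn T H r') (hu : u ∈ S)
    (h : (G ⊔ H ⊔ SimpleGraph.edge r r').Adj u v) : G.Adj u v ∨ u = r ∧ v = r' := by
  rcases h with (h | h) | h
  · exact Or.inl h
  · exact absurd (hH.adj_mem h) (Set.disjoint_left.1 hST hu)
  · rw [SimpleGraph.edge_adj] at h
    rcases h.1 with h | ⟨rfl, -⟩
    · exact Or.inr h
    · exact absurd hH.root_mem (Set.disjoint_left.1 hST hu)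

lemma glue_adj_right {S T : Set V} {G H : SimpleGraph V} {r r' u v : V} (hST : Disjoint S T)
    (hG : IsTreeOn S G r) (hu : u ∈ T)
    (h : (G ⊔ H ⊔ SimpleGraph.edge r r').Adj u v) : H.Adj u v ∨ u = r' ∧ v = r := by
  rw [sup_comm G H, SimpleGraph.edge_comm] at h
  exact glue_adj_left hST.symm hG hu h

lemma IsNearMIS.glue {S T J K : Set V} {G H : SimpleGraph V} {r r' : V} (hST : Disjoint S T)
    (hG : IsTreeOn S G r) (hH : IsTreeOn T H r') (hJ : IsNearMIS S G r J)
    (hK : IsNearMIS T H r' K) (h1 : ¬ (r ∈ J ∧ r' ∈ K))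
    (h2 : r ∈ J ∨ r' ∈ K ∨ ∃ u ∈ K, H.Adj r' u) :
    IsNearMIS (S ∪ T) (G ⊔ H ⊔ SimpleGraph.edge r r') r (J ∪ K) := by
  have hne : r ≠ r' := fun h => Set.disjoint_left.1 hST hG.root_mem (h ▸ hH.root_mem)
  refine ⟨Set.union_subset_union hJ.subset hK.subset, ?_, ?_⟩
  · rintro u (hu | hu) v hv h
    · rcases glue_adj_left hST hH (hJ.subset hu) h with h | ⟨rfl, rfl⟩
      · rcases hv with hv | hv
        · exact hJ.indep u hu v hv h
        · exact Set.disjoint_left.1 hST (hG.adj_mem h.symm) (hK.subset hv)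
      · rcases hv with hv | hv
        · exact Set.disjoint_left.1 hST (hJ.subset hv) hH.root_mem
        · exact h1 ⟨hu, hv⟩
    · rcases glue_adj_right hST hG (hK.subset hu) h with h | ⟨rfl, rfl⟩
      · rcases hv with hv | hv
        · exact Set.disjoint_left.1 hST (hJ.subset hv) (hH.adj_mem h.symm)
        · exact hK.indep u hu v hv h
      · rcases hv with hv | hv
        · exact h1 ⟨hv, hu⟩
        · exact Set.disjoint_left.1 hST hG.root_mem (hK.subset hv)
  · rintro v (hv | hv) hvJ hvr
    · obtain ⟨u, hu, h⟩ := hJ.dominated v hv (fun h => hvJ (Or.inl h)) hvr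
      exact ⟨u, Or.inl hu, Or.inl (Or.inl h)⟩
    · by_cases hvr' : v = r'
      · subst hvr'
        rcases h2 with h | h | ⟨u, hu, h⟩
        · exact ⟨r, Or.inl h, Or.inr (by simp [SimpleGraph.edge_adj, hne.symm])⟩
        · exact absurd (Or.inr h) hvJ
        · exact ⟨u, Or.inr hu, Or.inl (Or.inr h)⟩
      · obtain ⟨u, hu, h⟩ := hK.dominated v hv (fun h => hvJ (Or.inr h)) hvr'
        exact ⟨u, Or.inr hu, Or.inl (Or.inr h)⟩

lemma IsRootedTree.glue {P Q k : TreeKind} {S T : Set V} {s t : SimpleGraph V × V × Set V}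
    (hST : Disjoint S T) (hs : IsRootedTree P S s) (ht : IsRootedTree Q T t)
    (hk : P.glue Q = some k) : IsRootedTree k (S ∪ T) (glueTrees s t) := by
  obtain ⟨G, r, J⟩ := s
  obtain ⟨H, r', K⟩ := t
  obtain ⟨hG, hs⟩ := hs
  obtain ⟨hH, ht⟩ := ht
  refine ⟨hG.glue hST hH, ?_⟩
  have hne : r ≠ r' := fun h => Set.disjoint_left.1 hST hG.root_mem (h ▸ hH.root_mem)
  have hrT : r ∉ T := Set.disjoint_left.1 hST hG.root_mem
  simp only [glueTrees] at *
  have hadj : (G ⊔ H ⊔ SimpleGraph.edge r r').Adj r r' :=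
    Or.inr (by simp [SimpleGraph.edge_adj, hne])
  rcases hs with ⟨rfl, hs⟩ | ⟨hs, hs'⟩ <;> rcases ht with ⟨rfl, ht⟩ | ⟨ht, ht'⟩
  · obtain rfl : k = .any := by simpa [TreeKind.glue] using hk.symm
    simp [hs, ht]
  · cases Q <;> simp [TreeKind.glue, TreeKind.RootCond] at hk ht'
  · cases P <;> simp [TreeKind.glue, TreeKind.RootCond] at hk hs'
  · refine Or.inr ?_
    have hrK : r ∉ K := fun h => hrT (ht.subset h)
    cases P <;> cases Q <;> simp only [TreeKind.glue, TreeKind.RootCond, Option.some.injEq,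
      reduceCtorEq] at hk hs' ht' <;> subst hk <;>
      refine ⟨hs.glue hST hG hH ht (by tauto) (by tauto), ?_⟩
    · exact Or.inl hs'
    · exact Or.inl hs'
    · exact ⟨fun h => h.elim hs'.1 hrK, r', Or.inr ht', hadj⟩
    · obtain ⟨h1, u, hu, h⟩ := hs'
      exact ⟨fun h => h.elim h1 hrK, u, Or.inl hu, Or.inl (Or.inl h)⟩
    · exact ⟨fun h => h.elim hs'.1 hrK, r', Or.inr ht', hadj⟩
    · refine ⟨fun h => h.elim hs'.1 hrK, fun u hu h => ?_⟩
      rcases glue_adj_left hST hH hG.root_mem h with h | ⟨-, rfl⟩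
      · rcases hu with hu | hu
        · exact hs'.2 u hu h
        · exact Set.disjoint_left.1 hST (hG.adj_mem h.symm) (ht.subset hu)
      · rcases hu with hu | hu
        · exact Set.disjoint_left.1 hST (hs.subset hu) hH.root_mem
        · exact ht'.1 hu

end

section
variable {V : Type*}

lemma IsRootedTree.subset {k : TreeKind} {S : Set V} {t : SimpleGraph V × V × Set V}
    (h : IsRootedTree k S t) : t.2.2 ⊆ S := by
  rcases h.2 with h | h
  · simp [h.2]
  · exact h.1.subset

lemma glueTrees_subset {S T S' T' : Set V} {G H G' H' : SimpleGraph V} {r q q' v : V}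
    (hST : Disjoint S T) (hST' : Disjoint S' T') (hG : IsTreeOn S G r) (hH : IsTreeOn T H q)
    (hG' : IsTreeOn S' G' r) (hv : v ∈ T) (hv' : v ∈ T')
    (h : G ⊔ H ⊔ SimpleGraph.edge r q = G' ⊔ H' ⊔ SimpleGraph.edge r q')
    (hH' : IsTreeOn T' H' q') : T ⊆ T' := by
  intro w hw
  have hvw : H.Reachable v w := (hH.reachable v hv).symm.trans (hH.reachable w hw)
  refine hvw.mem_of_closed (fun a ha b hab => ?_) hv'
  have hab' : (G' ⊔ H' ⊔ SimpleGraph.edge r q').Adj a b := h ▸ Or.inl (Or.inr hab)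
  rcases glue_adj_right hST' hG' ha hab' with h1 | ⟨-, rfl⟩
  · exact hH'.adj_mem h1.symm
  · exact absurd (hH.adj_mem hab.symm) (Set.disjoint_left.1 hST hG.root_mem)

lemma glueTrees_left_le {S T : Set V} {G H G' H' : SimpleGraph V} {r q q' : V}
    (hST : Disjoint S T) (hG : IsTreeOn S G r)
    (h : G ⊔ H ⊔ SimpleGraph.edge r q = G' ⊔ H' ⊔ SimpleGraph.edge r q')
    (hH' : IsTreeOn T H' q') : G ≤ G' := by
  intro a b hab
  have hab' : (G' ⊔ H' ⊔ SimpleGraph.edge r q').Adj a b := h ▸ Or.inl (Or.inl hab)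
  rcases glue_adj_left hST hH' (hG.adj_mem hab) hab' with h1 | ⟨-, rfl⟩
  · exact h1
  · exact absurd hH'.root_mem (Set.disjoint_left.1 hST (hG.adj_mem hab.symm))

lemma glueTrees_root_eq {S T : Set V} {G H G' H' : SimpleGraph V} {r q q' : V}
    (hST : Disjoint S T) (hG : IsTreeOn S G r) (hH : IsTreeOn T H q)
    (h : G ⊔ H ⊔ SimpleGraph.edge r q = G' ⊔ H' ⊔ SimpleGraph.edge r q')
    (hG' : IsTreeOn S G' r) (hH' : IsTreeOn T H' q') : q = q' := by
  have hne : r ≠ q := fun h => Set.disjoint_left.1 hST hG.root_mem (h ▸ hH.root_mem)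
  have hadj : (G' ⊔ H' ⊔ SimpleGraph.edge r q').Adj r q :=
    h ▸ Or.inr (by simp [SimpleGraph.edge_adj, hne])
  rcases glue_adj_left hST hH' hG.root_mem hadj with h1 | ⟨-, h1⟩
  · exact absurd hH.root_mem (Set.disjoint_left.1 hST (hG'.adj_mem h1.symm))
  · exact h1

lemma eq_of_union_eq_of_disjoint {S T J J' K K' : Set V} (hST : Disjoint S T) (hJ : J ⊆ S)
    (hJ' : J' ⊆ S) (hK : K ⊆ T) (hK' : K' ⊆ T) (h : J ∪ K = J' ∪ K') : J = J' := by
  ext x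
  have h0 := Set.ext_iff.1 h x
  simp only [Set.mem_union] at h0
  have h1 := @hJ x
  have h2 := @hJ' x
  have h3 := @hK x
  have h4 := @hK' x
  have h5 : x ∈ S → x ∉ T := fun hx => Set.disjoint_left.1 hST hx
  tauto

lemma glueTrees_inj {P Q P' Q' : TreeKind} {S T S' T' : Set V}
    {s t s' t' : SimpleGraph V × V × Set V} {v : V}
    (hST : Disjoint S T) (hST' : Disjoint S' T') (hU : S ∪ T = S' ∪ T')
    (hs : IsRootedTree P S s) (ht : IsRootedTree Q T t)
    (hs' : IsRootedTree P' S' s') (ht' : IsRootedTree Q' T' t') (hv : v ∈ T) (hv' : v ∈ T')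
    (h : glueTrees s t = glueTrees s' t') : T = T' ∧ s = s' ∧ t = t' := by
  have hJ := hs.subset
  have hK := ht.subset
  have hJ' := hs'.subset
  have hK' := ht'.subset
  obtain ⟨G, r, J⟩ := s
  obtain ⟨H, q, K⟩ := t
  obtain ⟨G', r', J'⟩ := s'
  obtain ⟨H', q', K'⟩ := t'
  have hs := hs.1
  have ht := ht.1
  have hs' := hs'.1
  have ht' := ht'.1
  simp only [glueTrees, Prod.mk.injEq] at *
  obtain ⟨hE, rfl, hJK⟩ := h
  obtain rfl : T = T' := (glueTrees_subset hST hST' hs ht hs' hv hv' hE ht').antisymm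
    (glueTrees_subset hST' hST hs' ht' hs hv' hv hE.symm ht)
  obtain rfl : S = S' := by
    rw [← Set.union_sdiff_cancel_right (s := S) (t := T) (by rw [hST.inter_eq]),
      ← Set.union_sdiff_cancel_right (s := S') (t := T) (by rw [hST'.inter_eq]), hU]
  obtain rfl := glueTrees_root_eq hST hs ht hE hs' ht'
  refine ⟨rfl, ⟨?_, rfl, ?_⟩, ?_, rfl, ?_⟩
  · exact (glueTrees_left_le hST hs hE ht').antisymm (glueTrees_left_le hST hs' hE.symm ht)
  · exact eq_of_union_eq_of_disjoint hST hJ hJ' hK hK' hJK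
  · rw [sup_comm G H, sup_comm G' H', SimpleGraph.edge_comm] at hE
    exact (glueTrees_left_le hST.symm ht hE hs').antisymm
      (glueTrees_left_le hST.symm ht' hE.symm hs)
  · rw [Set.union_comm J, Set.union_comm J'] at hJK
    exact eq_of_union_eq_of_disjoint hST.symm hK hK' hJ hJ' hJK

lemma IsRootedTree.kind_unique {P Q : TreeKind} {S : Set V} {t : SimpleGraph V × V × Set V}
    (hP : IsRootedTree P S t) (hQ : IsRootedTree Q S t) (h : P = .any ↔ Q = .any) : P = Q := by
  rcases hP.2 with h1 | h1 <;> rcases hQ.2 with h2 | h2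
  · rw [h1.1, h2.1]
  · rw [h1.1, h.1 h1.1]
  · rw [h2.1, h.2 h2.1]
  · have h1 := h1.2
    have h2 := h2.2
    cases P <;> cases Q <;> simp only [TreeKind.RootCond] at h1 h2 <;> first | rfl | tauto
end

section
variable {V : Type*} [Fintype V] [DecidableEq V]

open Classical in
/-- The rooted trees of kind `k` on the vertex set `S`. -/
noncomputable def rootedTrees (k : TreeKind) (S : Finset V) :
    Finset (SimpleGraph V × V × Set V) :=
  Finset.univ.filter (IsRootedTree k (S : Set V))

lemma mem_rootedTrees {k : TreeKind} {S : Finset V} {t : SimpleGraph V × V × Set V} :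
    t ∈ rootedTrees k S ↔ IsRootedTree k (S : Set V) t := by
  simp [rootedTrees]

lemma sum_card_rootedTrees_le (k : TreeKind) (S : Finset V) :
    ∑ T ∈ S.powerset, ∑ pq : TreeKind × TreeKind, (if pq.1.glue pq.2 = some k then
      (rootedTrees pq.1 (S \ T)).card * ((rootedTrees pq.2 T).card * T.card) else 0) ≤
    (rootedTrees k S).card * (S.card - 1) := by
  classical
  have hR : ((rootedTrees k S).sigma fun t => S.erase t.2.1).card =
      (rootedTrees k S).card * (S.card - 1) := by
    rw [Finset.card_sigma, Finset.sum_const_nat]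
    intro t ht
    exact Finset.card_erase_of_mem (mem_rootedTrees.1 ht).1.root_mem
  rw [← hR, ← Finset.sum_product']
  simp_rw [← Finset.card_product]
  rw [← Finset.sum_filter, ← Finset.card_sigma]
  refine Finset.card_le_card_of_injOn (fun x => ⟨glueTrees x.2.1 x.2.2.1, x.2.2.2⟩) ?_ ?_
  · rintro ⟨⟨T, P, Q⟩, s, t, v⟩ hx
    simp only [Finset.coe_sigma, Set.mem_sigma_iff, Finset.mem_coe, Finset.mem_filter,
      Finset.mem_product, Finset.mem_powerset, Finset.mem_univ, mem_rootedTrees,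
      Finset.mem_erase] at hx ⊢
    obtain ⟨⟨⟨hT, -⟩, hk⟩, hs, ht, hv⟩ := hx
    have hd : Disjoint ((S \ T : Finset V) : Set V) (T : Set V) := by
      exact_mod_cast Finset.sdiff_disjoint
    refine ⟨?_, ?_, hT hv⟩
    · have := hs.glue hd ht hk
      rwa [← Finset.coe_union, Finset.sdiff_union_of_subset hT] at this
    · rintro rfl
      exact Set.disjoint_left.1 hd hs.1.root_mem hv
  · rintro ⟨⟨T, P, Q⟩, s, t, v⟩ hx ⟨⟨T', P', Q'⟩, s', t', v'⟩ hx' h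
    simp only [Finset.coe_sigma, Set.mem_sigma_iff, Finset.mem_coe, Finset.mem_filter,
      Finset.mem_product, Finset.mem_powerset, Finset.mem_univ, mem_rootedTrees] at hx hx'
    obtain ⟨⟨⟨hT, -⟩, hk⟩, hs, ht, hv⟩ := hx
    obtain ⟨⟨⟨hT', -⟩, hk'⟩, hs', ht', hv'⟩ := hx'
    simp only [Sigma.mk.injEq, heq_eq_eq] at h
    obtain ⟨h, rfl⟩ := h
    have hd : Disjoint ((S \ T : Finset V) : Set V) (T : Set V) := by
      exact_mod_cast Finset.sdiff_disjoint
    have hd' : Disjoint ((S \ T' : Finset V) : Set V) (T' : Set V) := by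
      exact_mod_cast Finset.sdiff_disjoint
    obtain ⟨h1, rfl, rfl⟩ := glueTrees_inj hd hd' (by
      rw [← Finset.coe_union, ← Finset.coe_union, Finset.sdiff_union_of_subset hT,
        Finset.sdiff_union_of_subset hT']) hs ht hs' ht' hv hv' h
    obtain rfl : T = T' := by exact_mod_cast h1
    have hany : ∀ {P Q k : TreeKind}, P.glue Q = some k →
        (P = .any ↔ k = .any) ∧ (Q = .any ↔ k = .any) := by
      intro P Q k h
      cases P <;> cases Q <;> simp [TreeKind.glue] at h <;> subst h <;> simp
    have hp := hany hk
    have hp' := hany hk'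
    obtain rfl := hs.kind_unique hs' (hp.1.trans hp'.1.symm)
    obtain rfl := ht.kind_unique ht' (hp.2.trans hp'.2.symm)
    rfl

end

/-- The coefficient of `x ^ n` in the exponential generating function of rooted trees of a given
kind, defined by the recursion that splits off the branch holding a marked non-root vertex. -/
noncomputable def treeCoeff : ℕ → TreeKind → ℝ
  | 0, _ => 0
  | 1, k => if k = .dom then 0 else 1
  | n + 2, k => (∑ i : Fin (n + 1), ∑ pq : TreeKind × TreeKind,
      if pq.1.glue pq.2 = some k then
        treeCoeff (i + 1) pq.1 * ((((n - i : ℕ) : ℝ) + 1) * treeCoeff (n - i + 1) pq.2)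
      else 0) / (n + 1)
termination_by n => n

lemma treeCoeff_rec (k : TreeKind) (n : ℕ) :
    ((n : ℝ) + 1) * treeCoeff (n + 2) k =
      ∑ p ∈ Finset.HasAntidiagonal.antidiagonal n, ∑ pq : TreeKind × TreeKind,
        if pq.1.glue pq.2 = some k then
          treeCoeff (p.1 + 1) pq.1 * (((p.2 : ℝ) + 1) * treeCoeff (p.2 + 1) pq.2) else 0 := by
  rw [treeCoeff, Finset.Nat.sum_antidiagonal_eq_sum_range_succ_mk, ← Fin.sum_univ_eq_sum_range
    (fun i => ∑ pq : TreeKind × TreeKind, if pq.1.glue pq.2 = some k then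
          treeCoeff (i + 1) pq.1 * ((((n - i : ℕ) : ℝ) + 1) * treeCoeff (n - i + 1) pq.2) else 0)]
  field_simp

lemma treeCoeff_nonneg (n : ℕ) (k : TreeKind) : 0 ≤ treeCoeff n k := by
  induction n using Nat.strong_induction_on generalizing k with
  | _ n ih =>
    match n, ih with
    | 0, _ => simp [treeCoeff]
    | 1, _ => rw [treeCoeff]; split_ifs <;> simp
    | n + 2, ih =>
      rw [treeCoeff]
      refine div_nonneg (Finset.sum_nonneg fun i _ => Finset.sum_nonneg fun pq _ => ?_)
        (by positivity)
      split_ifs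
      · exact mul_nonneg (ih _ (by omega) _)
          (mul_nonneg (by positivity) (ih _ (by omega) _))
      · exact le_rfl

section
variable {V : Type*} [Fintype V] [DecidableEq V]

lemma rootedTrees_singleton {k : TreeKind} (hk : k ≠ .dom) (v : V) :
    (rootedTrees k {v}).Nonempty := by
  have h : IsTreeOn ({v} : Set V) ⊥ v :=
    ⟨rfl, fun h => h.elim, fun w hw => by rw [Set.mem_singleton_iff.1 hw],
      SimpleGraph.isAcyclic_bot⟩
  cases k
  · exact ⟨(⊥, v, ∅), mem_rootedTrees.2 ⟨by simpa using h, Or.inl ⟨rfl, rfl⟩⟩⟩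
  · refine ⟨(⊥, v, {v}), mem_rootedTrees.2 ⟨by simpa using h, Or.inr ⟨⟨by simp, by simp, ?_⟩, rfl⟩⟩⟩
    intro w hw h1 h2
    exact absurd (by simpa using hw) h2
  · exact absurd rfl hk
  · refine ⟨(⊥, v, ∅), mem_rootedTrees.2 ⟨by simpa using h, Or.inr ⟨⟨by simp, by simp, ?_⟩,
      by simp [TreeKind.RootCond]⟩⟩⟩
    intro w hw h1 h2
    exact absurd (by simpa using hw) h2

lemma factorial_mul_treeCoeff_le (k : TreeKind) (S : Finset V) :
    (S.card.factorial : ℝ) * treeCoeff S.card k ≤ (rootedTrees k S).card := by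
  induction hn : S.card using Nat.strong_induction_on generalizing k S with
  | _ n ih =>
    match n, ih with
    | 0, _ => simp [treeCoeff]
    | 1, _ =>
      rw [treeCoeff]
      split_ifs with hk
      · simp
      · obtain ⟨v, rfl⟩ := Finset.card_eq_one.1 hn
        simpa using rootedTrees_singleton hk v
    | n + 2, ih =>
      have h1 := sum_card_rootedTrees_le k S
      have h2 : (∑ T ∈ S.powerset, ∑ pq : TreeKind × TreeKind, (if pq.1.glue pq.2 = some k then
          ((rootedTrees pq.1 (S \ T)).card : ℝ) * ((rootedTrees pq.2 T).card * T.card) else 0)) ≤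
          (rootedTrees k S).card * ((n : ℝ) + 1) := by
        rw [hn] at h1
        have : ((n : ℝ) + 1) = ((n + 2 - 1 : ℕ) : ℝ) := by simp
        rw [this]
        exact_mod_cast h1
      set F : ℕ → ℝ := fun j => ∑ pq : TreeKind × TreeKind, (if pq.1.glue pq.2 = some k then
          (((n + 2 - j).factorial : ℝ) * treeCoeff (n + 2 - j) pq.1) *
            ((j.factorial * treeCoeff j pq.2) * j) else 0) with hF
      have h3 : ∑ T ∈ S.powerset, F T.card ≤ (rootedTrees k S).card * ((n : ℝ) + 1) := by
        refine le_trans (Finset.sum_le_sum fun T hT => ?_) h2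
        rw [Finset.mem_powerset] at hT
        have hTc := Finset.card_le_card hT
        have hsd := Finset.card_sdiff_of_subset hT
        rw [hn] at hsd
        refine Finset.sum_le_sum fun pq _ => ?_
        split_ifs with hpq
        · rcases Nat.eq_zero_or_pos T.card with h0 | h0
          · rw [h0]; simp
          rcases hTc.lt_or_eq with hlt | heq
          · refine mul_le_mul ?_ (mul_le_mul_of_nonneg_right ?_ (by positivity)) ?_ (by positivity)
            · exact ih _ (by omega) _ (S \ T) hsd
            · exact ih _ (by omega) _ T rfl
            · exact mul_nonneg (mul_nonneg (by positivity) (treeCoeff_nonneg _ _)) (by positivity)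
          · rw [heq, hn, Nat.sub_self]
            simp only [treeCoeff, mul_zero, zero_mul]
            positivity
        · exact le_rfl
      have h4 : ∑ T ∈ S.powerset, F T.card = ((n + 2).factorial : ℝ) *
          (((n : ℝ) + 1) * treeCoeff (n + 2) k) := by
        rw [Finset.sum_powerset_apply_card, hn, treeCoeff_rec, Finset.sum_range_succ,
          Finset.sum_range_succ']
        have e1 : F (n + 2) = 0 := by simp [hF, treeCoeff]
        have e2 : F 0 = 0 := by simp [hF]
        rw [e1, e2, smul_zero, smul_zero, add_zero, add_zero,
          Finset.Nat.sum_antidiagonal_eq_sum_range_succ_mk, ← Finset.sum_range_reflect,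
          Finset.mul_sum]
        refine Finset.sum_congr rfl fun j hj => ?_
        rw [Finset.mem_range] at hj
        have e3 : n + 1 - 1 - j + 1 = n + 1 - j := by omega
        have e4 : n + 2 - (n + 1 - j) = j + 1 := by omega
        have e5 : n - j + 1 = n + 1 - j := by omega
        have e6 : ((n - j : ℕ) : ℝ) + 1 = ((n + 1 - j : ℕ) : ℝ) := by exact_mod_cast e5
        have e7 : ((n + 2).choose (n + 1 - j) : ℝ) * (n + 1 - j).factorial * (j + 1).factorial =
            (n + 2).factorial := by
          have := Nat.choose_mul_factorial_mul_factorial (show n + 1 - j ≤ n + 2 by omega)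
          rw [e4] at this
          exact_mod_cast this
        rw [hF, e3, nsmul_eq_mul, Finset.mul_sum, Finset.mul_sum]
        refine Finset.sum_congr rfl fun pq _ => ?_
        simp only [e4, e5, e6]
        split_ifs
        · rw [← e7]; ring
        · simp
      rw [h4] at h3
      have h5 : (0 : ℝ) < (n : ℝ) + 1 := by positivity
      refine le_of_mul_le_mul_right ?_ h5
      linarith

end

lemma sum_treeKind {M : Type*} [AddCommMonoid M] (f : TreeKind → M) :
    ∑ k, f k = f .any + (f .mem + (f .dom + f .undom)) := by
  rw [show (Finset.univ : Finset TreeKind) = {.any, .mem, .dom, .undom} from rfl]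
  simp

lemma treeCoeff_any_rec (n : ℕ) : ((n : ℝ) + 1) * treeCoeff (n + 2) .any =
    ∑ p ∈ Finset.HasAntidiagonal.antidiagonal n,
      treeCoeff (p.1 + 1) .any * (((p.2 : ℝ) + 1) * treeCoeff (p.2 + 1) .any) := by
  simp [treeCoeff_rec, Fintype.sum_prod_type, sum_treeKind, TreeKind.glue]

lemma treeCoeff_mem_rec (n : ℕ) : ((n : ℝ) + 1) * treeCoeff (n + 2) .mem =
    ∑ p ∈ Finset.HasAntidiagonal.antidiagonal n, treeCoeff (p.1 + 1) .mem *
      (((p.2 : ℝ) + 1) * (treeCoeff (p.2 + 1) .dom + treeCoeff (p.2 + 1) .undom)) := by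
  simp [treeCoeff_rec, Fintype.sum_prod_type, sum_treeKind, TreeKind.glue, mul_add]

lemma treeCoeff_undom_rec (n : ℕ) : ((n : ℝ) + 1) * treeCoeff (n + 2) .undom =
    ∑ p ∈ Finset.HasAntidiagonal.antidiagonal n,
      treeCoeff (p.1 + 1) .undom * (((p.2 : ℝ) + 1) * treeCoeff (p.2 + 1) .dom) := by
  simp [treeCoeff_rec, Fintype.sum_prod_type, sum_treeKind, TreeKind.glue]

lemma treeCoeff_dom_add_undom_rec (n : ℕ) :
    ((n : ℝ) + 1) * (treeCoeff (n + 2) .dom + treeCoeff (n + 2) .undom) =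
    ∑ p ∈ Finset.HasAntidiagonal.antidiagonal n,
      (treeCoeff (p.1 + 1) .dom + treeCoeff (p.1 + 1) .undom) *
      (((p.2 : ℝ) + 1) * (treeCoeff (p.2 + 1) .mem + treeCoeff (p.2 + 1) .dom)) := by
  rw [mul_add, treeCoeff_undom_rec, treeCoeff_rec, ← Finset.sum_add_distrib]
  refine Finset.sum_congr rfl fun p _ => ?_
  simp [Fintype.sum_prod_type, sum_treeKind, TreeKind.glue]
  ring

lemma mul_treeCoeff_le {P Q k : TreeKind} (h : P.glue Q = some k) (m n : ℕ) :
    treeCoeff (m + 1) P * (((n : ℝ) + 1) * treeCoeff (n + 1) Q) ≤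
      ((m : ℝ) + n + 1) * treeCoeff (m + n + 2) k := by
  have h0 : ∀ (p : ℕ × ℕ) (pq : TreeKind × TreeKind), 0 ≤ if pq.1.glue pq.2 = some k then
      treeCoeff (p.1 + 1) pq.1 * (((p.2 : ℝ) + 1) * treeCoeff (p.2 + 1) pq.2) else 0 := by
    intro p pq
    split_ifs
    · exact mul_nonneg (treeCoeff_nonneg _ _) (mul_nonneg (by positivity) (treeCoeff_nonneg _ _))
    · exact le_rfl
  have h1 := treeCoeff_rec k (m + n)
  push_cast at h1
  rw [h1]
  refine le_trans ?_ (Finset.single_le_sum (f := fun p : ℕ × ℕ => ∑ pq : TreeKind × TreeKind,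
    if pq.1.glue pq.2 = some k then
      treeCoeff (p.1 + 1) pq.1 * (((p.2 : ℝ) + 1) * treeCoeff (p.2 + 1) pq.2) else 0)
    (fun p _ => Finset.sum_nonneg fun pq _ => h0 p pq)
    (Finset.HasAntidiagonal.mem_antidiagonal.2 (rfl : (m, n).1 + (m, n).2 = m + n)))
  refine le_trans ?_ (Finset.single_le_sum (fun pq _ => h0 (m, n) pq) (Finset.mem_univ (P, Q)))
  simp [h]

lemma treeCoeff_mul_le {k : TreeKind} (h : k.glue k = some k) {m n : ℕ} (hm : 1 ≤ m)
    (hn : 1 ≤ n) : treeCoeff m k / 2 * (treeCoeff n k / 2) ≤ treeCoeff (m + n) k / 2 := by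
  wlog hmn : m ≤ n generalizing m n
  · rw [mul_comm, add_comm]
    exact this hn hm (by omega)
  obtain ⟨m, rfl⟩ := Nat.exists_eq_add_of_le' hm
  obtain ⟨n, rfl⟩ := Nat.exists_eq_add_of_le' hn
  have h1 := mul_treeCoeff_le h m n
  rw [show m + 1 + (n + 1) = m + n + 2 by ring]
  have h2 : (m : ℝ) + n + 1 ≤ 2 * ((n : ℝ) + 1) := by
    have : (m : ℝ) ≤ n := by exact_mod_cast Nat.le_of_succ_le_succ hmn
    linarith
  have h3 := treeCoeff_nonneg (m + n + 2) k
  have h4 : ((n : ℝ) + 1) * (treeCoeff (m + 1) k * treeCoeff (n + 1) k) ≤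
      ((n : ℝ) + 1) * (2 * treeCoeff (m + n + 2) k) := by nlinarith
  have h5 := le_of_mul_le_mul_left h4 (by positivity)
  linarith

lemma treeCoeff_any_one : treeCoeff 1 .any = 1 := by simp [treeCoeff]
lemma treeCoeff_mem_one : treeCoeff 1 .mem = 1 := by simp [treeCoeff]
lemma treeCoeff_dom_one : treeCoeff 1 .dom = 0 := by simp [treeCoeff]
lemma treeCoeff_undom_one : treeCoeff 1 .undom = 1 := by simp [treeCoeff]

lemma treeCoeff_any_pos {n : ℕ} (hn : 1 ≤ n) : 0 < treeCoeff n .any := by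
  induction n, hn using Nat.le_induction with
  | base => simp [treeCoeff_any_one]
  | succ n hn ih =>
    have := treeCoeff_mul_le (k := .any) rfl hn le_rfl
    rw [treeCoeff_any_one] at this
    linarith

lemma treeCoeff_mem_le (n : ℕ) : treeCoeff n .mem ≤ treeCoeff (n + 1) .dom := by
  cases n with
  | zero => simp [treeCoeff]
  | succ n =>
    have h := mul_treeCoeff_le (P := .undom) (Q := .mem) rfl 0 n
    rw [treeCoeff_undom_one] at h
    simp only [CharP.cast_eq_zero, zero_add, one_mul] at h
    exact le_of_mul_le_mul_left h (by positivity)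

lemma treeCoeff_undom_le (n : ℕ) : treeCoeff n .undom ≤ n * treeCoeff (n + 1) .dom := by
  cases n with
  | zero => simp [treeCoeff]
  | succ n =>
    have h := mul_treeCoeff_le (P := .undom) (Q := .mem) rfl n 0
    rw [treeCoeff_mem_one] at h
    simpa using h

lemma treeCoeff_dom_pos {n : ℕ} (hn : 2 ≤ n) : 0 < treeCoeff n .dom := by
  have h2 : 1 ≤ treeCoeff 2 .dom := by
    simpa [treeCoeff_mem_one] using treeCoeff_mem_le 1
  have h3 : 1 ≤ treeCoeff 3 .dom := by
    have h := mul_treeCoeff_le (P := .mem) (Q := .undom) rfl 0 0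
    rw [treeCoeff_mem_one, treeCoeff_undom_one] at h
    norm_num at h
    exact h.trans (treeCoeff_mem_le 2)
  induction n using Nat.strong_induction_on with
  | _ n ih =>
    match n, hn, ih with
    | 2, _, _ => linarith
    | 3, _, _ => linarith
    | n + 4, _, ih =>
      have := treeCoeff_mul_le (k := .dom) rfl (show 1 ≤ n + 2 by omega) (show 1 ≤ 2 by omega)
      have h4 := ih (n + 2) (by omega) (by omega)
      have : 0 < treeCoeff (n + 2) .dom / 2 * (treeCoeff 2 .dom / 2) := by positivity
      rw [show n + 4 = n + 2 + 2 by ring]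
      linarith

lemma exists_growth_rate {β : ℕ → ℝ} {M : ℝ} (hpos : ∀ n, 2 ≤ n → 0 < β n)
    (hmul : ∀ m n, 2 ≤ m → 2 ≤ n → β m * β n ≤ β (m + n)) (hM : 0 ≤ M)
    (hbd : ∀ n, 2 ≤ n → β n ≤ M ^ n) :
    ∃ L : ℝ, 0 < L ∧ (∀ n, 2 ≤ n → β n ≤ L ^ n) ∧
      ∀ q, 0 < q → q < L → ∃ c > 0, ∀ n, 2 ≤ n → c * q ^ n ≤ β n := by
  set f : {n : ℕ // 2 ≤ n} → ℝ := fun n => β n ^ ((n : ℕ) : ℝ)⁻¹ with hf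
  have hfpow : ∀ n, f n ^ (n : ℕ) = β n := fun n =>
    Real.rpow_inv_natCast_pow (hpos n n.2).le (by have := n.2; omega)
  have hf0 : ∀ n, 0 < f n := fun n => Real.rpow_pos_of_pos (hpos n n.2) _
  have hbdd : BddAbove (Set.range f) := by
    refine ⟨M, ?_⟩
    rintro _ ⟨n, rfl⟩
    refine le_of_pow_le_pow_left₀ (n := (n : ℕ)) (by have := n.2; omega) hM ?_
    rw [hfpow]
    exact hbd n n.2
  refine ⟨⨆ n, f n, (hf0 ⟨2, le_rfl⟩).trans_le (le_ciSup hbdd _), fun n hn => ?_,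
    fun q hq hqL => ?_⟩
  · rw [← hfpow ⟨n, hn⟩]
    exact pow_le_pow_left₀ (hf0 _).le (le_ciSup hbdd _) _
  · have : Nonempty {n : ℕ // 2 ≤ n} := ⟨⟨2, le_rfl⟩⟩
    obtain ⟨⟨m, hm⟩, hmq⟩ := exists_lt_of_lt_ciSup hqL
    have hβm : q ^ m ≤ β m := by
      rw [← hfpow ⟨m, hm⟩]
      exact pow_le_pow_left₀ hq.le hmq.le _
    obtain ⟨c, hc, hcm⟩ : ∃ c > 0, ∀ s ∈ Finset.Ico 2 (m + 2), c * q ^ s ≤ β s := by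
      have hne : (Finset.Ico 2 (m + 2)).Nonempty := ⟨2, by simp; omega⟩
      obtain ⟨s₀, hs₀, hmin⟩ := Finset.exists_min_image (Finset.Ico 2 (m + 2))
        (fun s => β s / q ^ s) hne
      refine ⟨β s₀ / q ^ s₀, div_pos (hpos _ (Finset.mem_Ico.1 hs₀).1) (by positivity),
        fun s hs => ?_⟩
      have := hmin s hs
      rwa [le_div_iff₀ (by positivity)] at this
    refine ⟨c, hc, fun n => ?_⟩
    induction n using Nat.strong_induction_on with
    | _ n ih =>
      intro hn
      by_cases hnm : n < m + 2
      · exact hcm n (Finset.mem_Ico.2 ⟨hn, hnm⟩)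
      · have h1 := ih (n - m) (by omega) (by omega)
        have h2 := hmul m (n - m) hm (by omega)
        rw [Nat.add_sub_cancel' (by omega)] at h2
        calc c * q ^ n = q ^ m * (c * q ^ (n - m)) := by
              rw [← Nat.add_sub_cancel' (show m ≤ n by omega), pow_add]
              simp; ring
          _ ≤ β m * β (n - m) := mul_le_mul hβm h1 (by positivity) (hpos m hm).le
          _ ≤ β n := h2

lemma hasDerivAt_tsum_mul_pow {c : ℕ → ℝ} {ρ x : ℝ} (hc : ∀ n, 0 ≤ c n)
    (hs : Summable fun n : ℕ => (n : ℝ) * c n * ρ ^ (n - 1)) (hx : |x| < ρ) :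
    HasDerivAt (fun y => ∑' n, c n * y ^ n) (∑' n : ℕ, ((n : ℝ) + 1) * c (n + 1) * x ^ n) x ∧
      Summable fun n : ℕ => ‖((n : ℝ) + 1) * c (n + 1) * x ^ n‖ := by
  have hb : ∀ (n : ℕ) (y : ℝ), |y| < ρ →
      ‖(n : ℝ) * c n * y ^ (n - 1)‖ ≤ (n : ℝ) * c n * ρ ^ (n - 1) := by
    intro n y hy
    rw [norm_mul, norm_pow, Real.norm_eq_abs, Real.norm_eq_abs,
      abs_of_nonneg (mul_nonneg n.cast_nonneg (hc n))]
    have := hc n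
    gcongr
  have hsx : Summable fun n : ℕ => (n : ℝ) * c n * x ^ (n - 1) :=
    Summable.of_norm_bounded hs fun n => hb n x hx
  have key := hasDerivAt_tsum_of_isPreconnected (t := Metric.ball (0 : ℝ) ρ)
    (g := fun n y => c n * y ^ n) (g' := fun n y => (n : ℝ) * c n * y ^ (n - 1)) (y₀ := 0) (y := x)
    hs Metric.isOpen_ball (convex_ball 0 ρ).isPreconnected
    (fun n y _ => by
      have := (hasDerivAt_pow n y).const_mul (c n)
      exact this.congr_deriv (by ring))
    (fun n y hy => hb n y (by simpa using hy))
    (by simpa using (abs_nonneg x).trans_lt hx)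
    (summable_of_ne_finset_zero (s := {0}) (fun n hn => by
      simp only [Finset.mem_singleton] at hn
      simp [hn]))
    (by simpa using hx)
  constructor
  · refine key.congr_deriv ?_
    rw [hsx.tsum_eq_zero_add]
    simp
  · have := (summable_nat_add_iff 1).2 hsx.norm
    simpa using this

lemma tsum_eq_mul_exp {y z : ℕ → ℝ} {ρ r : ℝ} (hy : ∀ n, 0 ≤ y n) (hz : ∀ n, 0 ≤ z n)
    (hy0 : y 0 = 0) (hy1 : y 1 = 1) (hz0 : z 0 = 0)
    (hrec : ∀ n : ℕ, ((n : ℝ) + 1) * y (n + 2) =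
      ∑ p ∈ Finset.HasAntidiagonal.antidiagonal n, y (p.1 + 1) * (((p.2 : ℝ) + 1) * z (p.2 + 1)))
    (hsy : Summable fun n : ℕ => (n : ℝ) * y (n + 1) * ρ ^ (n - 1))
    (hsz : Summable fun n : ℕ => (n : ℝ) * z n * ρ ^ (n - 1)) (hr0 : 0 ≤ r) (hr : r < ρ) :
    ∑' n, y n * r ^ n = r * Real.exp (∑' n, z n * r ^ n) := by
  set G : ℝ → ℝ := fun x => ∑' n, y (n + 1) * x ^ n with hG
  set Z : ℝ → ℝ := fun x => ∑' n, z n * x ^ n with hZ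
  have hsG : ∀ x, |x| < ρ → Summable fun n => ‖y (n + 1) * x ^ n‖ := by
    intro x hx
    have h0 : 0 ≤ ρ := (abs_nonneg x).trans hx.le
    refine (summable_nat_add_iff 1).1 (Summable.of_nonneg_of_le (fun n => norm_nonneg _)
      (fun n => ?_) (((summable_nat_add_iff 1).2 hsy).mul_left |x|))
    rw [norm_mul, norm_pow, Real.norm_eq_abs, Real.norm_eq_abs, abs_of_nonneg (hy _)]
    have h1 : |x| ^ n ≤ ρ ^ n := by gcongr
    have h2 := hy (n + 1 + 1)
    calc y (n + 1 + 1) * |x| ^ (n + 1) = |x| * (1 * y (n + 1 + 1) * |x| ^ n) := by ring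
      _ ≤ |x| * (((n + 1 : ℕ) : ℝ) * y (n + 1 + 1) * ρ ^ (n + 1 - 1)) := by
        rw [Nat.add_sub_cancel]
        have : (1 : ℝ) ≤ ((n + 1 : ℕ) : ℝ) := by simp
        gcongr
  have hd : ∀ x ∈ Metric.ball (0 : ℝ) ρ, HasDerivAt (fun x => G x * Real.exp (-Z x)) 0 x := by
    intro x hx
    have hx : |x| < ρ := by simpa using hx
    obtain ⟨h1, h1s⟩ := hasDerivAt_tsum_mul_pow (c := fun n => y (n + 1)) (fun n => hy _) hsy hx
    obtain ⟨h2, h2s⟩ := hasDerivAt_tsum_mul_pow hz hsz hx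
    have h3 : ∑' n : ℕ, ((n : ℝ) + 1) * y (n + 1 + 1) * x ^ n =
        G x * ∑' n : ℕ, ((n : ℝ) + 1) * z (n + 1) * x ^ n := by
      rw [hG, tsum_mul_tsum_eq_tsum_sum_antidiagonal_of_summable_norm (hsG x hx) h2s]
      congr 1; ext n
      rw [hrec, Finset.sum_mul]
      refine Finset.sum_congr rfl fun p hp => ?_
      rw [← Finset.HasAntidiagonal.mem_antidiagonal.1 hp, pow_add]; ring
    have h4 := h1.mul h2.neg.exp
    refine h4.congr_deriv ?_
    change _ * Real.exp (-Z x) + G x * (Real.exp (-Z x) * _) = 0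
    rw [h3]; ring
  have hρ : 0 < ρ := hr0.trans_lt hr
  have hconst : G r * Real.exp (-Z r) = G 0 * Real.exp (-Z 0) := by
    refine (convex_ball (0 : ℝ) ρ).is_const_of_fderivWithin_eq_zero (𝕜 := ℝ)
      (f := fun x => G x * Real.exp (-Z x))
      (fun x hx => (hd x hx).differentiableAt.differentiableWithinAt) (fun x hx => ?_)
      (by simpa [abs_of_nonneg hr0] using hr) (by simpa using hρ)
    rw [fderivWithin_of_isOpen Metric.isOpen_ball hx, (hd x hx).hasFDerivAt.fderiv]
    ext; simp
  have hG0 : G 0 = 1 := by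
    rw [hG]; simp only
    rw [tsum_eq_single 0 (fun n hn => by simp [hn])]; simp [hy1]
  have hZ0 : Z 0 = 0 := by
    rw [hZ]; simp only
    rw [tsum_eq_single 0 (fun n hn => by simp [hn])]; simp [hz0]
  rw [hG0, hZ0, Real.exp_neg, neg_zero, Real.exp_zero, one_mul] at hconst
  have hGr : G r = Real.exp (Z r) := by
    field_simp at hconst
    exact hconst
  have hsr := (hsG r (by rwa [abs_of_nonneg hr0])).of_norm
  have hsy' : Summable fun n => y n * r ^ n := by
    refine (summable_nat_add_iff 1).1 ((hsr.mul_left r).congr fun n => ?_)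
    ring
  rw [hsy'.tsum_eq_zero_add, hy0, zero_mul, zero_add, ← hGr, hG, ← tsum_mul_left]
  congr 1; ext n; ring

lemma exp_supersolution {t : ℝ} (ht : t = 0.288789 * Real.exp 0.3466) :
    0.288789 * Real.exp 0.3466 *
      (Real.exp (0.288789 * Real.exp (t + 0.3466)) - 1) ≤ 0.3466 := by
  have h1 : Real.exp 0.3466 ≤ 1.414251 := by
    refine (Real.exp_bound' (by norm_num) (by norm_num) (n := 10) (by norm_num)).trans ?_
    norm_num [Finset.sum_range_succ, Nat.factorial]
  have h2 : t + 0.3466 ≤ 0.7550202 := by rw [ht]; linarith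
  have h3 : Real.exp (t + 0.3466) ≤ 2.1276546 := by
    refine (Real.exp_le_exp.2 h2).trans ?_
    refine (Real.exp_bound' (by norm_num) (by norm_num) (n := 12) (by norm_num)).trans ?_
    norm_num [Finset.sum_range_succ, Nat.factorial]
  have h4 : Real.exp (0.288789 * Real.exp (t + 0.3466)) ≤ 1.8486275 := by
    refine (Real.exp_le_exp.2 (show _ ≤ (0.6144434 : ℝ) by linarith)).trans ?_
    refine (Real.exp_bound' (by norm_num) (by norm_num) (n := 10) (by norm_num)).trans ?_
    norm_num [Finset.sum_range_succ, Nat.factorial]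
  have h5 : 0 ≤ Real.exp 0.3466 := (Real.exp_pos _).le
  nlinarith

lemma mul_one_add_sub_le_exp {y₀ E y : ℝ} (hE : E ≤ Real.exp y₀) (hy : 0 ≤ 1 + (y - y₀)) :
    E * (1 + (y - y₀)) ≤ Real.exp y := by
  have h1 : 1 + (y - y₀) ≤ Real.exp (y - y₀) := by
    linarith [Real.add_one_le_exp (y - y₀)]
  calc E * (1 + (y - y₀)) ≤ Real.exp y₀ * Real.exp (y - y₀) :=
        mul_le_mul hE h1 hy (Real.exp_pos _).le
    _ = Real.exp y := by rw [← Real.exp_add]; ring_nf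

lemma exp_system_no_solution {A B C : ℝ} (hB0 : 0 ≤ B)
    (hA : A = 0.288791 * Real.exp (B + C)) (hC : C = 0.288791 * Real.exp B)
    (hB : B + C = 0.288791 * Real.exp (A + B)) : False := by
  have h1 : (1.4142509 : ℝ) ≤ Real.exp 0.3466 := by
    refine le_trans ?_ (Real.sum_le_exp_of_nonneg (by norm_num) 10)
    norm_num [Finset.sum_range_succ, Nat.factorial]
  have h2 : (2.1276602 : ℝ) ≤ Real.exp 0.7550229 := by
    refine le_trans ?_ (Real.sum_le_exp_of_nonneg (by norm_num) 12)
    norm_num [Finset.sum_range_succ, Nat.factorial]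
  have h3 : (1.8486377 : ℝ) ≤ Real.exp 0.614449 := by
    refine le_trans ?_ (Real.sum_le_exp_of_nonneg (by norm_num) 10)
    norm_num [Finset.sum_range_succ, Nat.factorial]
  have e1 := mul_one_add_sub_le_exp h1 (y := B) (by linarith)
  have hC' : 0.4084229 + 0.4084229 * (B - 0.3466) ≤ C := by linarith
  have e2 := mul_one_add_sub_le_exp h2 (y := B + C) (by linarith)
  have hA' : 0.614449 + 0.8654041 * (B - 0.3466) ≤ A := by linarith
  have e3 := mul_one_add_sub_le_exp h3 (y := A) (by linarith)
  have hB' : B = 0.288791 * Real.exp B * (Real.exp A - 1) := by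
    rw [Real.exp_add] at hB; linear_combination hB - hC
  have h4 : 0.8486375 + 1.5998184 * (B - 0.3466) ≤ Real.exp A - 1 := by linarith
  have h5 : 0.288791 * (1.4142509 * (1 + (B - 0.3466))) *
      (0.8486375 + 1.5998184 * (B - 0.3466)) ≤ B := by
    refine le_trans ?_ hB'.ge
    exact mul_le_mul (mul_le_mul_of_nonneg_left e1 (by norm_num)) h4
      (by linarith) (by positivity)
  nlinarith [sq_nonneg (B - 0.3466)]

lemma summable_mul_mul_pow_sub_one {y : ℕ → ℝ} {K L ρ : ℝ} (hy : ∀ n, 0 ≤ y n)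
    (hyK : ∀ n, y n ≤ K * ((n : ℝ) + 1) * L ^ n) (hL : 0 < L) (hρ : 0 < ρ) (h : ρ * L < 1) :
    Summable fun n : ℕ => (n : ℝ) * y n * ρ ^ (n - 1) := by
  have h0 : ‖ρ * L‖ < 1 := by rwa [Real.norm_of_nonneg (by positivity)]
  have h1 := summable_pow_mul_geometric_of_norm_lt_one 2 h0
  have h2 := summable_pow_mul_geometric_of_norm_lt_one 1 h0
  refine Summable.of_nonneg_of_le (fun n => ?_) (fun n => ?_) ((h1.add h2).mul_left (K * ρ⁻¹))
  · have := hy n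
    positivity
  · rcases n with _ | n
    · simp
    · have := hyK (n + 1)
      have h3 : (0 : ℝ) ≤ ((n + 1 : ℕ) : ℝ) * ρ ^ n := by positivity
      calc ((n + 1 : ℕ) : ℝ) * y (n + 1) * ρ ^ n = (((n + 1 : ℕ) : ℝ) * ρ ^ n) * y (n + 1) := by
            ring
        _ ≤ (((n + 1 : ℕ) : ℝ) * ρ ^ n) * (K * (((n + 1 : ℕ) : ℝ) + 1) * L ^ (n + 1)) :=
            mul_le_mul_of_nonneg_left this h3
        _ = _ := by
            rw [mul_pow, pow_succ ρ]
            field_simp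

lemma tsum_eq_mul_exp_of_le {y z : ℕ → ℝ} {K L r : ℝ} (hy : ∀ n, 0 ≤ y n) (hz : ∀ n, 0 ≤ z n)
    (hy0 : y 0 = 0) (hy1 : y 1 = 1) (hz0 : z 0 = 0)
    (hrec : ∀ n : ℕ, ((n : ℝ) + 1) * y (n + 2) =
      ∑ p ∈ Finset.HasAntidiagonal.antidiagonal n, y (p.1 + 1) * (((p.2 : ℝ) + 1) * z (p.2 + 1)))
    (hyK : ∀ n, y n ≤ K * ((n : ℝ) + 1) * L ^ n) (hzK : ∀ n, z n ≤ K * ((n : ℝ) + 1) * L ^ n)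
    (hL : 0 < L) (hr : 0 < r) (hrL : r * L < 1) :
    ∑' n, y n * r ^ n = r * Real.exp (∑' n, z n * r ^ n) := by
  obtain ⟨ρ, hρ1, hρ2⟩ := exists_between ((lt_div_iff₀ hL).2 hrL)
  rw [lt_div_iff₀ hL] at hρ2
  have hρ : 0 < ρ := hr.trans hρ1
  have hK : 0 ≤ K := by simpa [hy0] using hyK 0
  refine tsum_eq_mul_exp (ρ := ρ) hy hz hy0 hy1 hz0 hrec
    (summable_mul_mul_pow_sub_one (K := 2 * K * L) (L := L) (fun n => hy _) (fun n => ?_) hL hρ hρ2)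
    (summable_mul_mul_pow_sub_one hz hzK hL hρ hρ2) hr.le hρ1
  refine (hyK (n + 1)).trans ?_
  push_cast
  rw [pow_succ]
  have : (n : ℝ) + 1 + 1 ≤ 2 * (n + 1) := by linarith [n.cast_nonneg (α := ℝ)]
  calc K * ((n : ℝ) + 1 + 1) * (L ^ n * L) ≤ K * (2 * (n + 1)) * (L ^ n * L) := by gcongr
    _ = _ := by ring

lemma summable_mul_pow {y : ℕ → ℝ} {K L r : ℝ} (hy : ∀ n, 0 ≤ y n)
    (hyK : ∀ n, y n ≤ K * ((n : ℝ) + 1) * L ^ n) (hL : 0 < L) (hr : 0 < r) (h : r * L < 1) :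
    Summable fun n => y n * r ^ n := by
  have := (summable_nat_add_iff 1).2 (summable_mul_mul_pow_sub_one hy hyK hL hr h)
  refine (summable_nat_add_iff 1).1 (Summable.of_nonneg_of_le (fun n => ?_) (fun n => ?_)
    (this.mul_left r))
  · have := hy (n + 1)
    positivity
  · have h1 := hy (n + 1)
    have h2 : (1 : ℝ) ≤ ((n + 1 : ℕ) : ℝ) := by simp
    rw [Nat.add_sub_cancel, pow_succ]
    calc y (n + 1) * (r ^ n * r) = r * (1 * y (n + 1) * r ^ n) := by ring
      _ ≤ _ := by gcongr

lemma treeCoeff_zero (k : TreeKind) : treeCoeff 0 k = 0 := by simp [treeCoeff]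

lemma exists_any_solution {L r : ℝ} (h : ∀ n, 2 ≤ n → treeCoeff n .any / 2 ≤ L ^ n) (hL : 0 < L)
    (hr : 0 < r) (hrL : r * L < 1) : ∃ T : ℝ, 0 < T ∧ T = r * Real.exp T := by
  have hb : ∀ n, treeCoeff n .any ≤ (2 + L⁻¹) * ((n : ℝ) + 1) * L ^ n := by
    intro n
    rcases Nat.lt_or_ge n 2 with hn | hn
    · interval_cases n
      · rw [treeCoeff_zero]; positivity
      · rw [treeCoeff_any_one]
        have : (2 + L⁻¹) * (((1 : ℕ) : ℝ) + 1) * L ^ 1 = 4 * L + 2 := by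
          field_simp; push_cast; ring
        rw [this]; linarith
    · have h1 := h n hn
      have h2 : 0 < L⁻¹ := by positivity
      have h3 : 0 < L ^ n := by positivity
      have h4 : (2 : ℝ) ≤ (2 + L⁻¹) * ((n : ℝ) + 1) := by
        nlinarith [n.cast_nonneg (α := ℝ)]
      nlinarith
  have key := tsum_eq_mul_exp_of_le (fun n => treeCoeff_nonneg n .any)
    (fun n => treeCoeff_nonneg n .any) (treeCoeff_zero _) treeCoeff_any_one (treeCoeff_zero _)
    treeCoeff_any_rec hb hb hL hr hrL
  exact ⟨_, by rw [key]; positivity, key⟩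

lemma exists_mis_solution {L r : ℝ} (h : ∀ n, 2 ≤ n → treeCoeff n .dom / 2 ≤ L ^ n) (hL : 0 < L)
    (hr : 0 < r) (hrL : r * L < 1) : ∃ A B C : ℝ, 0 ≤ B ∧ A = r * Real.exp (B + C) ∧
      C = r * Real.exp B ∧ B + C = r * Real.exp (A + B) := by
  have hdom : ∀ n, treeCoeff n .dom ≤ 2 * L ^ n := by
    intro n
    rcases Nat.lt_or_ge n 2 with hn | hn
    · interval_cases n
      · rw [treeCoeff_zero]; positivity
      · rw [treeCoeff_dom_one]; positivity
    · linarith [h n hn]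
  have hb : ∀ n, treeCoeff n .dom ≤ (2 + 4 * L) * ((n : ℝ) + 1) * L ^ n := by
    intro n
    refine (hdom n).trans ?_
    gcongr
    nlinarith [n.cast_nonneg (α := ℝ)]
  have ha : ∀ n, treeCoeff n .mem ≤ (2 * L) * ((n : ℝ) + 1) * L ^ n := by
    intro n
    refine (treeCoeff_mem_le n).trans ((hdom _).trans ?_)
    rw [pow_succ]
    have h1 : (0 : ℝ) ≤ n * (L * L ^ n) := by positivity
    linarith
  have hc : ∀ n, treeCoeff n .undom ≤ (2 * L) * ((n : ℝ) + 1) * L ^ n := by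
    intro n
    refine (treeCoeff_undom_le n).trans
      ((mul_le_mul_of_nonneg_left (hdom _) n.cast_nonneg).trans ?_)
    rw [pow_succ]
    have h1 : (0 : ℝ) ≤ L * L ^ n := by positivity
    linarith
  set K := 2 + 8 * L with hK
  have hKle : ∀ {x y : ℝ} (n : ℕ), x ≤ y → y ≤ K → x * ((n : ℝ) + 1) * L ^ n ≤
      K * ((n : ℝ) + 1) * L ^ n := by
    intro x y n h1 h2
    have := h1.trans h2
    gcongr
  have ha0 := fun n => treeCoeff_nonneg n .mem
  have hb0 := fun n => treeCoeff_nonneg n .dom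
  have hc0 := fun n => treeCoeff_nonneg n .undom
  have hbK : ∀ n, treeCoeff n .dom ≤ K * ((n : ℝ) + 1) * L ^ n :=
    fun n => (hb n).trans (hKle n le_rfl (by linarith))
  have haK : ∀ n, treeCoeff n .mem ≤ K * ((n : ℝ) + 1) * L ^ n :=
    fun n => (ha n).trans (hKle n le_rfl (by linarith))
  have hcK : ∀ n, treeCoeff n .undom ≤ K * ((n : ℝ) + 1) * L ^ n :=
    fun n => (hc n).trans (hKle n le_rfl (by linarith))
  have hbcK : ∀ n, treeCoeff n .dom + treeCoeff n .undom ≤ K * ((n : ℝ) + 1) * L ^ n := by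
    intro n
    have := hKle n (x := 2 + 4 * L + 2 * L) le_rfl (by linarith)
    linarith [hb n, hc n]
  have habK : ∀ n, treeCoeff n .mem + treeCoeff n .dom ≤ K * ((n : ℝ) + 1) * L ^ n := by
    intro n
    have := hKle n (x := 2 + 4 * L + 2 * L) le_rfl (by linarith)
    linarith [ha n, hb n]
  have sa := summable_mul_pow ha0 haK hL hr hrL
  have sb := summable_mul_pow hb0 hbK hL hr hrL
  have sc := summable_mul_pow hc0 hcK hL hr hrL
  refine ⟨∑' n, treeCoeff n .mem * r ^ n, ∑' n, treeCoeff n .dom * r ^ n,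
    ∑' n, treeCoeff n .undom * r ^ n,
    tsum_nonneg fun n => mul_nonneg (hb0 n) (by positivity), ?_, ?_, ?_⟩
  · rw [← sb.tsum_add sc]
    simp_rw [← add_mul]
    exact tsum_eq_mul_exp_of_le ha0 (fun n => add_nonneg (hb0 n) (hc0 n)) (treeCoeff_zero _)
      treeCoeff_mem_one (by simp [treeCoeff_zero]) treeCoeff_mem_rec haK hbcK hL hr hrL
  · exact tsum_eq_mul_exp_of_le hc0 hb0 (treeCoeff_zero _) treeCoeff_undom_one (treeCoeff_zero _)
      treeCoeff_undom_rec hcK hbK hL hr hrL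
  · rw [← sb.tsum_add sc, ← sa.tsum_add sb]
    simp_rw [← add_mul]
    exact tsum_eq_mul_exp_of_le (fun n => add_nonneg (hb0 n) (hc0 n))
      (fun n => add_nonneg (ha0 n) (hb0 n)) (by simp [treeCoeff_zero])
      (by simp [treeCoeff_dom_one, treeCoeff_undom_one]) (by simp [treeCoeff_zero])
      treeCoeff_dom_add_undom_rec hbcK habK hL hr hrL

lemma SimpleGraph.IsAcyclic.exists_parent {V : Type*} {G : SimpleGraph V} (hG : G.IsAcyclic) :
    ∃ p : V → Option V, ∀ u v, G.Adj u v ↔ p u = some v ∨ p v = some u := by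
  classical
  have hρ : ∀ v, ∃ r : V, (G.connectedComponentMk v).out = r := fun v => ⟨_, rfl⟩
  choose ρ hρ using hρ
  have hreach : ∀ v, G.Reachable v (ρ v) := fun v => by
    rw [← hρ]
    exact (SimpleGraph.ConnectedComponent.eq.1 (Quot.out_eq (G.connectedComponentMk v))).symm
  have hpath : ∀ v, ∃ w : G.Walk v (ρ v), w.IsPath := fun v => (hreach v).exists_isPath
  choose P hP using hpath
  refine ⟨fun v => if v = ρ v then none else some (P v).snd, fun u v => ⟨fun h => ?_, ?_⟩⟩
  · have hr : ρ u = ρ v := by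
      rw [← hρ, ← hρ, SimpleGraph.ConnectedComponent.eq.2 h.reachable]
    by_cases hv : v ∈ (P u).support
    · left
      have hne : u ≠ ρ u := by
        intro hu
        have : (P u).Nil := by
          have := (hP u)
          generalize P u = q at this
          revert q
          rw [← hu]
          intro q hq
          exact SimpleGraph.Walk.isPath_iff_nil.1 hq
        rw [SimpleGraph.Walk.nil_iff_support_eq.1 this] at hv
        exact h.ne (List.mem_singleton.1 hv).symm
      have h1 : (P u).takeUntil v hv = SimpleGraph.Walk.cons h .nil :=
        congrArg Subtype.val ((hG.subsingleton_path _ _).elim ⟨_, (hP u).takeUntil hv⟩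
          ⟨_, (SimpleGraph.Path.singleton h).2⟩)
      have h2 := (P u).take_spec hv
      rw [h1] at h2
      simp only [if_neg hne]
      rw [← h2]
      simp
    · right
      have hne : v ≠ ρ v := by
        intro h'
        exact hv (by rw [h', ← hr]; exact (P u).end_mem_support)
      simp only [if_neg hne]
      have h1 : P v = (SimpleGraph.Walk.cons h.symm (P u)).copy rfl hr :=
        congrArg Subtype.val ((hG.subsingleton_path _ _).elim ⟨_, hP v⟩
          ⟨(SimpleGraph.Walk.cons h.symm (P u)).copy rfl hr, by
            simpa using ⟨hP u, hv⟩⟩)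
      rw [h1]
      simp [SimpleGraph.Walk.snd]
  · have key : ∀ u v, (if u = ρ u then none else some (P u).snd) = some v → G.Adj u v := by
      intro u v h
      split_ifs at h with hu
      rw [← Option.some.inj h]
      exact (P u).adj_snd fun hn => hu hn.eq
    rintro (h | h)
    · exact key _ _ h
    · exact (key _ _ h).symm

section
variable {V : Type*} [Fintype V] [DecidableEq V]

/-- The maps that send `D` to `T` or `none`, hit all of `T`, and are `none` off `D`. -/
def onParentMaps (D T : Finset V) : Finset (V → Option V) :=
  {f | (∀ v ∈ D, ∀ b, f v = some b → b ∈ T) ∧ (∀ v ∉ D, f v = none) ∧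
    ∀ b ∈ T, ∃ v ∈ D, f v = some b}

omit [Fintype V] in
lemma sum_powerset_factorial_mul_pow_le {s : ℝ} (hs : 0 ≤ s) (D : Finset V) :
    ∑ S ∈ D.powerset.erase ∅, ((D \ S).card.factorial : ℝ) * s ^ S.card ≤
      D.card.factorial * (Real.exp s - 1) := by
  have h1 : ∑ S ∈ D.powerset, ((D \ S).card.factorial : ℝ) * s ^ S.card =
      D.card.factorial * ∑ j ∈ Finset.range (D.card + 1), s ^ j / j.factorial := by
    have : ∀ S ∈ D.powerset, ((D \ S).card.factorial : ℝ) * s ^ S.card =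
        (fun j => ((D.card - j).factorial : ℝ) * s ^ j) S.card := fun S hS => by
      rw [Finset.card_sdiff_of_subset (Finset.mem_powerset.1 hS)]
    rw [Finset.sum_congr rfl this,
      Finset.sum_powerset_apply_card fun j => ((D.card - j).factorial : ℝ) * s ^ j, Finset.mul_sum]
    refine Finset.sum_congr rfl fun j hj => ?_
    have hj' : j ≤ D.card := Nat.lt_succ_iff.1 (Finset.mem_range.1 hj)
    rw [nsmul_eq_mul, ← Nat.choose_mul_factorial_mul_factorial hj']
    push_cast
    have : (j.factorial : ℝ) ≠ 0 := by positivity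
    field_simp
  have h2 := Finset.add_sum_erase D.powerset
    (fun S => ((D \ S).card.factorial : ℝ) * s ^ S.card) (Finset.empty_mem_powerset D)
  have h3 := mul_le_mul_of_nonneg_left (Real.sum_le_exp_of_nonneg hs (D.card + 1))
    (Nat.cast_nonneg (α := ℝ) D.card.factorial)
  simp only [Finset.sdiff_empty, Finset.card_empty, pow_zero, mul_one] at h2
  linarith

lemma card_onParentMaps_insert_le (D T : Finset V) {b : V} (hb : b ∉ T) :
    (onParentMaps D (insert b T)).card ≤
      ∑ S ∈ D.powerset.erase ∅, (onParentMaps (D \ S) T).card := by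
  rw [← Finset.card_sigma]
  refine Finset.card_le_card_of_injOn
    (fun f => ⟨D.filter fun v => f v = some b, fun v => if f v = some b then none else f v⟩)
    (fun f hf => ?_) fun f hf g hg h => ?_
  · simp only [onParentMaps, Finset.coe_filter, Finset.mem_univ, true_and, Set.mem_ofPred_eq,
      Finset.mem_insert] at hf
    obtain ⟨h1, h2, h3⟩ := hf
    simp only [Finset.coe_sigma, Set.mem_sigma_iff, onParentMaps, Finset.mem_coe,
      Finset.mem_erase, Finset.mem_powerset, Finset.mem_filter, Finset.mem_univ, true_and,
      Finset.mem_sdiff]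
    refine ⟨⟨?_, Finset.filter_subset _ _⟩, ?_, ?_, ?_⟩
    · obtain ⟨v, hv, hvb⟩ := h3 b (.inl rfl)
      exact Finset.ne_empty_of_mem (Finset.mem_filter.2 ⟨hv, hvb⟩)
    · rintro v ⟨hv, hv'⟩ c hc
      split_ifs at hc with hvb
      rcases h1 v hv c hc with rfl | h
      · exact absurd hc hvb
      · exact h
    · intro v hv
      split_ifs with hvb
      · rfl
      · exact h2 v fun h => hv ⟨h, fun h' => hvb h'.2⟩
    · intro c hc
      obtain ⟨v, hv, hvc⟩ := h3 c (.inr hc)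
      have : f v ≠ some b := by
        rw [hvc]
        rintro ⟨⟩
        exact hb hc
      exact ⟨v, ⟨hv, fun h => this h.2⟩, by rw [if_neg this, hvc]⟩
  · simp only [onParentMaps, Finset.coe_filter, Finset.mem_univ, true_and,
      Set.mem_ofPred_eq] at hf hg
    simp only [Sigma.mk.injEq, heq_eq_eq] at h
    funext v
    have hv := congrFun h.2 v
    have hS : ∀ v, v ∈ D → (f v = some b ↔ g v = some b) := fun v hv => by
      have := Finset.ext_iff.1 h.1 v
      simpa [hv] using this
    by_cases hD : v ∈ D
    · by_cases hfb : f v = some b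
      · rw [hfb, (hS v hD).1 hfb]
      · rwa [if_neg hfb, if_neg fun h => hfb ((hS v hD).2 h)] at hv
    · rw [hf.2.1 v hD, hg.2.1 v hD]

lemma card_onParentMaps_mul_pow_le {s : ℝ} (hs : 0 ≤ s) (D T : Finset V) :
    ((onParentMaps D T).card : ℝ) * s ^ D.card ≤
      D.card.factorial * Real.exp s * (Real.exp s - 1) ^ T.card := by
  induction T using Finset.induction_on generalizing D with
  | empty =>
    have h1 : (onParentMaps D (∅ : Finset V)).card ≤ 1 := by
      refine Finset.card_le_one.2 fun f hf g hg => ?_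
      have key : ∀ f ∈ onParentMaps D (∅ : Finset V), f = fun _ => none := fun f hf => by
        simp only [onParentMaps, Finset.mem_filter] at hf
        funext v
        by_cases hv : v ∈ D
        · rcases h : f v with _ | b
          · rfl
          · exact absurd (hf.2.1 v hv b h) (Finset.notMem_empty b)
        · exact hf.2.2.1 v hv
      rw [key f hf, key g hg]
    have h2 := Real.pow_div_factorial_le_exp s hs D.card
    rw [div_le_iff₀ (by positivity)] at h2
    have h3 : ((onParentMaps D (∅ : Finset V)).card : ℝ) ≤ 1 := by exact_mod_cast h1
    have h4 : 0 ≤ s ^ D.card := by positivity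
    rw [Finset.card_empty, pow_zero, mul_one]
    nlinarith
  | insert b T hb ih =>
    have hE : 0 ≤ Real.exp s - 1 := by linarith [Real.add_one_le_exp s]
    calc ((onParentMaps D (insert b T)).card : ℝ) * s ^ D.card
        ≤ (∑ S ∈ D.powerset.erase ∅, ((onParentMaps (D \ S) T).card : ℝ)) * s ^ D.card := by
          gcongr
          exact_mod_cast card_onParentMaps_insert_le D T hb
      _ ≤ ∑ S ∈ D.powerset.erase ∅, ((D \ S).card.factorial : ℝ) * s ^ S.card *
            (Real.exp s * (Real.exp s - 1) ^ T.card) := by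
          rw [Finset.sum_mul]
          refine Finset.sum_le_sum fun S hS => ?_
          have hS' : S ⊆ D := Finset.mem_powerset.1 (Finset.mem_of_mem_erase hS)
          rw [← Finset.card_sdiff_add_card_eq_card hS', pow_add]
          have := mul_le_mul_of_nonneg_right (ih (D \ S)) (pow_nonneg hs S.card)
          linarith
      _ ≤ D.card.factorial * (Real.exp s - 1) * (Real.exp s * (Real.exp s - 1) ^ T.card) := by
          rw [← Finset.sum_mul]
          gcongr
          exact sum_powerset_factorial_mul_pow_le hs D
      _ = _ := by
          rw [Finset.card_insert_of_notMem hb]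
          ring
end

lemma IsMaximalIndepSet.exists_adj {V : Type*} {G : SimpleGraph V} {J : Set V}
    (h : IsMaximalIndepSet G J) {v : V} (hv : v ∉ J) : ∃ u ∈ J, G.Adj v u := by
  by_contra! hno
  refine h.2 (insert v J) ?_ (Set.ssubset_insert hv)
  rintro a b (rfl | ha) (rfl | hb)
  · exact G.loopless.irrefl _
  · exact hno b hb
  · exact fun hab => hno a ha hab.symm
  · exact h.1 ha hb

section
variable {V : Type*} [Fintype V] [DecidableEq V]

/-- Candidate parent maps of a forest with maximal independent set `J` in which `T` is the set of
parents of vertices of `J`. -/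
def misParentMaps (J T : Finset V) : Finset (V → Option V) :=
  {p | (fun v => if v ∈ J then p v else none) ∈ onParentMaps J T ∧
    ∀ v ∉ J, v ∉ T → ∃ j ∈ J, p v = some j}

lemma card_misParentMaps_le {J T : Finset V} (hT : T ⊆ Jᶜ) :
    (misParentMaps J T).card ≤ (onParentMaps J T).card *
      ((Fintype.card V + 1) ^ T.card * J.card ^ (Jᶜ \ T).card) := by
  let P : Finset (V → Option V) := Fintype.piFinset fun v =>
    if v ∈ J then {none} else if v ∈ T then Finset.univ else J.map .some
  have hP : P.card = (Fintype.card V + 1) ^ T.card * J.card ^ (Jᶜ \ T).card := by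
    have h1 : ∀ v, (if v ∈ J then {none} else if v ∈ T then Finset.univ else J.map .some :
        Finset (Option V)).card =
        (if v ∈ T then Fintype.card V + 1 else 1) * (if v ∈ Jᶜ \ T then J.card else 1) := by
      intro v
      by_cases hJ : v ∈ J
      · have : v ∉ T := fun h => Finset.mem_compl.1 (hT h) hJ
        simp [hJ, this]
      · by_cases h : v ∈ T <;> simp [hJ, h]
    rw [Fintype.card_piFinset, Finset.prod_congr rfl fun v _ => h1 v, Finset.prod_mul_distrib]
    simp only [Finset.prod_ite_mem, Finset.univ_inter, Finset.prod_const]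
  rw [← hP, ← Finset.card_product]
  refine Finset.card_le_card_of_injOn
    (fun p => (fun v => if v ∈ J then p v else none, fun v => if v ∈ J then none else p v))
    (fun p hp => ?_) fun p _ q _ h => ?_
  · simp only [misParentMaps, Finset.mem_coe, Finset.mem_filter, Finset.mem_univ, true_and] at hp
    simp only [Finset.coe_product, Set.mem_prod, Finset.mem_coe, P, Fintype.mem_piFinset]
    refine ⟨hp.1, fun v => ?_⟩
    by_cases hJ : v ∈ J
    · simp [hJ]
    · by_cases h : v ∈ T
      · simp [hJ, h]
      · obtain ⟨j, hj, hvj⟩ := hp.2 v hJ h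
        simp [hJ, h, hvj, hj]
  · simp only [Prod.mk.injEq] at h
    funext v
    have h1 := congrFun h.1 v
    have h2 := congrFun h.2 v
    by_cases hJ : v ∈ J
    · simpa [hJ] using h1
    · simpa [hJ] using h2

lemma card_misParentMaps_mul_pow_le {J T : Finset V} (hT : T ⊆ Jᶜ) {r s t u : ℝ} (hr : 0 < r)
    (hs : 0 < s) (ht : 0 < t) (hu : 0 < u) (h1 : r * Real.exp (t + u) ≤ s)
    (h2 : r * (Real.exp u * (Real.exp s - 1)) ≤ u) (h3 : r * Real.exp u ≤ t) :
    ((misParentMaps J T).card : ℝ) * r ^ Fintype.card V ≤ Real.exp s * Real.exp u *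
      (J.card.factorial * (T.card.factorial * (Jᶜ \ T).card.factorial)) := by
  have hn : Fintype.card V = J.card + (T.card + (Jᶜ \ T).card) := by
    have := Finset.card_sdiff_add_card_eq_card hT
    have := Finset.card_compl_add_card J
    omega
  set a := J.card
  set b := T.card
  set c := (Jᶜ \ T).card
  have hE : 0 ≤ Real.exp s - 1 := by linarith [Real.add_one_le_exp s]
  have hb : ((Fintype.card V + 1 : ℕ) : ℝ) ^ b * u ^ b ≤
      b.factorial * (Real.exp u * Real.exp u ^ Fintype.card V) := by
    have := Real.pow_div_factorial_le_exp (((Fintype.card V + 1 : ℕ) : ℝ) * u) (by positivity) b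
    rw [div_le_iff₀ (by positivity), mul_pow] at this
    rw [← pow_succ', ← Real.exp_nat_mul]
    linarith
  have hc : (a : ℝ) ^ c * t ^ c ≤ c.factorial * Real.exp t ^ a := by
    have := Real.pow_div_factorial_le_exp ((a : ℝ) * t) (by positivity) c
    rw [div_le_iff₀ (by positivity), mul_pow] at this
    rw [← Real.exp_nat_mul]
    linarith
  have ha := card_onParentMaps_mul_pow_le hs.le J T
  have hm : ((misParentMaps J T).card : ℝ) ≤ (onParentMaps J T).card *
      (((Fintype.card V + 1 : ℕ) : ℝ) ^ b * (a : ℝ) ^ c) := by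
    exact_mod_cast card_misParentMaps_le hT
  have hpos : 0 < s ^ a * u ^ b * t ^ c := by positivity
  refine le_of_mul_le_mul_right ?_ hpos
  calc ((misParentMaps J T).card : ℝ) * r ^ Fintype.card V * (s ^ a * u ^ b * t ^ c)
      ≤ (onParentMaps J T).card * (((Fintype.card V + 1 : ℕ) : ℝ) ^ b * (a : ℝ) ^ c) *
          r ^ Fintype.card V * (s ^ a * u ^ b * t ^ c) := by gcongr
    _ = ((onParentMaps J T).card * s ^ a) * ((((Fintype.card V + 1 : ℕ) : ℝ) ^ b * u ^ b) *
          ((a : ℝ) ^ c * t ^ c)) * r ^ Fintype.card V := by ring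
    _ ≤ (a.factorial * Real.exp s * (Real.exp s - 1) ^ b) *
          ((b.factorial * (Real.exp u * Real.exp u ^ Fintype.card V)) *
          (c.factorial * Real.exp t ^ a)) * r ^ Fintype.card V := by
        gcongr
    _ = Real.exp s * Real.exp u * (a.factorial * (b.factorial * c.factorial)) *
          ((r * Real.exp (t + u)) ^ a * (r * (Real.exp u * (Real.exp s - 1))) ^ b *
            (r * Real.exp u) ^ c) := by
        rw [hn, Real.exp_add]
        generalize Real.exp s - 1 = z
        ring
    _ ≤ Real.exp s * Real.exp u * (a.factorial * (b.factorial * c.factorial)) *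
          (s ^ a * u ^ b * t ^ c) := by
        gcongr

omit [Fintype V] in
lemma sum_powerset_factorial_mul_factorial (D : Finset V) :
    ∑ S ∈ D.powerset, (S.card.factorial * (D \ S).card.factorial : ℝ) =
      (D.card + 1) * D.card.factorial := by
  have : ∀ S ∈ D.powerset, (S.card.factorial * (D \ S).card.factorial : ℝ) =
      (fun j => (j.factorial * (D.card - j).factorial : ℝ)) S.card := fun S hS => by
    rw [Finset.card_sdiff_of_subset (Finset.mem_powerset.1 hS)]
  rw [Finset.sum_congr rfl this, Finset.sum_powerset_apply_card
    fun j => (j.factorial * (D.card - j).factorial : ℝ)]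
  have h : ∀ j ∈ Finset.range (D.card + 1),
      D.card.choose j • (j.factorial * (D.card - j).factorial : ℝ) = D.card.factorial :=
    fun j hj => by
      rw [nsmul_eq_mul, ← Nat.choose_mul_factorial_mul_factorial
        (Nat.lt_succ_iff.1 (Finset.mem_range.1 hj))]
      push_cast
      ring
  rw [Finset.sum_congr rfl h]
  simp

lemma sum_sum_factorial_le :
    ∑ J : Finset V, ∑ T ∈ Jᶜ.powerset,
      (J.card.factorial * (T.card.factorial * (Jᶜ \ T).card.factorial) : ℝ) ≤
      (Fintype.card V + 1) ^ 2 * (Fintype.card V).factorial := by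
  have h1 : ∀ J : Finset V, ∑ T ∈ Jᶜ.powerset,
      (J.card.factorial * (T.card.factorial * (Jᶜ \ T).card.factorial) : ℝ) ≤
      (Fintype.card V + 1) * (J.card.factorial * (Finset.univ \ J).card.factorial) := by
    intro J
    rw [← Finset.mul_sum, sum_powerset_factorial_mul_factorial, ← Finset.compl_eq_univ_sdiff]
    have : (Jᶜ.card : ℝ) ≤ Fintype.card V := by exact_mod_cast Finset.card_le_univ _
    have h : (0 : ℝ) ≤ J.card.factorial * Jᶜ.card.factorial := by positivity
    nlinarith
  refine (Finset.sum_le_sum fun J _ => h1 J).trans ?_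
  rw [← Finset.mul_sum, ← Finset.powerset_univ, sum_powerset_factorial_mul_factorial,
    Finset.card_univ]
  exact le_of_eq (by ring)

lemma card_forest_mis_le :
    Nat.card {p : SimpleGraph V × Set V // p.1.IsAcyclic ∧ IsMaximalIndepSet p.1 p.2} ≤
      ∑ J : Finset V, ∑ T ∈ Jᶜ.powerset, (misParentMaps J T).card := by
  classical
  let I : Finset (Σ _ : Finset V, Σ _ : Finset V, V → Option V) :=
    Finset.univ.sigma fun J => Jᶜ.powerset.sigma fun T => misParentMaps J T
  have hI : I.card = ∑ J : Finset V, ∑ T ∈ Jᶜ.powerset, (misParentMaps J T).card := by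
    simp only [I, Finset.card_sigma]
  rw [← hI, Nat.card_eq_fintype_card, ← Finset.card_univ]
  choose par hpar using fun G : {G : SimpleGraph V // G.IsAcyclic} => G.2.exists_parent
  refine Finset.card_le_card_of_injOn
    (fun x => ⟨x.1.2.toFinset,
      ({v | v ∉ x.1.2 ∧ ∃ j ∈ x.1.2, par ⟨x.1.1, x.2.1⟩ j = some v} : Set V).toFinset,
      par ⟨x.1.1, x.2.1⟩⟩) ?_ ?_
  · rintro ⟨⟨G, J⟩, hG, hJ⟩ -
    have hp := hpar ⟨G, hG⟩
    simp only [I, Finset.coe_sigma, Set.mem_sigma_iff, Finset.mem_coe, Finset.mem_univ, true_and,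
      Finset.mem_powerset, misParentMaps, onParentMaps, Finset.mem_filter, Set.mem_toFinset,
      Set.mem_ofPred_eq]
    refine ⟨fun v hv => ?_, ⟨fun v hv b hb => ?_, fun v hv => if_neg hv, ?_⟩, ?_⟩
    · simp only [Set.mem_toFinset, Set.mem_ofPred_eq] at hv
      simpa using hv.1
    · rw [if_pos hv] at hb
      exact ⟨fun hbJ => hJ.1 hv hbJ ((hp v b).2 (.inl hb)), v, hv, hb⟩
    · rintro b ⟨hb, j, hj, hjb⟩
      exact ⟨j, hj, by rw [if_pos hj, hjb]⟩
    · intro v hv hvT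
      obtain ⟨u, hu, huv⟩ := hJ.exists_adj hv
      refine ⟨u, hu, ((hp v u).1 huv).resolve_right fun h => hvT ⟨hv, u, hu, h⟩⟩
  · rintro ⟨⟨G, J⟩, hG, hJ⟩ - ⟨⟨G', J'⟩, hG', hJ'⟩ - h
    simp only [Sigma.mk.injEq, heq_eq_eq, Set.toFinset_inj] at h
    have hGG : G = G' := by
      ext u v
      rw [hpar ⟨G, hG⟩ u v, hpar ⟨G', hG'⟩ u v, h.2.2]
    simp [hGG, h.1]

lemma card_forest_mis_mul_pow_le {r s t u : ℝ} (hr : 0 < r)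
    (hs : 0 < s) (ht : 0 < t) (hu : 0 < u) (h1 : r * Real.exp (t + u) ≤ s)
    (h2 : r * (Real.exp u * (Real.exp s - 1)) ≤ u) (h3 : r * Real.exp u ≤ t) :
    (Nat.card {p : SimpleGraph V × Set V // p.1.IsAcyclic ∧ IsMaximalIndepSet p.1 p.2} : ℝ) *
      r ^ Fintype.card V ≤ Real.exp s * Real.exp u *
        ((Fintype.card V + 1) ^ 2 * (Fintype.card V).factorial) := by
  calc (Nat.card {p : SimpleGraph V × Set V // p.1.IsAcyclic ∧ IsMaximalIndepSet p.1 p.2} : ℝ) *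
        r ^ Fintype.card V
      ≤ (∑ J : Finset V, ∑ T ∈ Jᶜ.powerset, ((misParentMaps J T).card : ℝ)) *
          r ^ Fintype.card V := by
        gcongr
        exact_mod_cast card_forest_mis_le
    _ ≤ Real.exp s * Real.exp u * ∑ J : Finset V, ∑ T ∈ Jᶜ.powerset,
          (J.card.factorial * (T.card.factorial * (Jᶜ \ T).card.factorial) : ℝ) := by
        rw [Finset.sum_mul, Finset.mul_sum]
        refine Finset.sum_le_sum fun J _ => ?_
        rw [Finset.sum_mul, Finset.mul_sum]
        exact Finset.sum_le_sum fun T hT =>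
          card_misParentMaps_mul_pow_le (Finset.mem_powerset.1 hT) hr hs ht hu h1 h2 h3
    _ ≤ _ := by
        gcongr
        exact sum_sum_factorial_le

lemma card_forest_le :
    Nat.card {G : SimpleGraph V // G.IsAcyclic} ≤ (Fintype.card V + 1) ^ Fintype.card V := by
  choose par hpar using fun G : {G : SimpleGraph V // G.IsAcyclic} => G.2.exists_parent
  have hinj : Function.Injective par := fun G G' h => Subtype.ext <| by
    ext u v
    rw [hpar G u v, hpar G' u v, h]
  refine (Nat.card_le_card_of_injective par hinj).trans (le_of_eq ?_)
  simp [Nat.card_eq_fintype_card]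
end

section
variable {V : Type*} [Fintype V] [DecidableEq V]

lemma card_rootedTrees_any_le :
    (rootedTrees .any (Finset.univ : Finset V)).card ≤
      Fintype.card V * Nat.card {G : SimpleGraph V // G.IsAcyclic} := by
  rw [← Nat.card_eq_fintype_card, ← Nat.card_prod, ← Fintype.card_coe, ← Nat.card_eq_fintype_card]
  have key : ∀ t ∈ rootedTrees .any (Finset.univ : Finset V), t.2.2 = ∅ := fun t ht => by
    rcases (mem_rootedTrees.1 ht).2 with h | h
    · exact h.2
    · exact h.2.elim
  refine Nat.card_le_card_of_injective
    (fun t => (t.1.2.1, ⟨t.1.1, (mem_rootedTrees.1 t.2).1.acyclic⟩)) fun t t' h => ?_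
  simp only [Prod.mk.injEq, Subtype.mk.injEq] at h
  exact Subtype.ext (Prod.ext h.2 (Prod.ext h.1 ((key _ t.2).trans (key _ t'.2).symm)))

lemma IsRootedTree.isMaximalIndepSet {t : SimpleGraph V × V × Set V}
    (h : IsRootedTree .dom ((Finset.univ : Finset V) : Set V) t) :
    IsMaximalIndepSet t.1 t.2.2 := by
  obtain ⟨hnear, -, hroot⟩ := h.2.resolve_left fun h => by simp at h
  refine ⟨fun u v hu hv => hnear.indep u hu v hv, fun J' hJ' hlt => ?_⟩
  obtain ⟨v, hv, hvJ⟩ := Set.exists_of_ssubset hlt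
  have : ∃ u ∈ t.2.2, t.1.Adj v u := by
    by_cases hvr : v = t.2.1
    · exact hvr ▸ hroot
    · exact hnear.dominated v (by simp) hvJ hvr
  obtain ⟨u, hu, hvu⟩ := this
  exact hJ' hv (hlt.1 hu) hvu

lemma card_rootedTrees_dom_le :
    (rootedTrees .dom (Finset.univ : Finset V)).card ≤ Fintype.card V *
      Nat.card {p : SimpleGraph V × Set V // p.1.IsAcyclic ∧ IsMaximalIndepSet p.1 p.2} := by
  rw [← Nat.card_eq_fintype_card, ← Nat.card_prod, ← Fintype.card_coe, ← Nat.card_eq_fintype_card]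
  refine Nat.card_le_card_of_injective
    (fun t => (t.1.2.1, ⟨(t.1.1, t.1.2.2), (mem_rootedTrees.1 t.2).1.acyclic,
      (mem_rootedTrees.1 t.2).isMaximalIndepSet⟩)) fun t t' h => ?_
  simp only [Prod.mk.injEq, Subtype.mk.injEq] at h
  exact Subtype.ext (Prod.ext h.2.1 (Prod.ext h.1 h.2.2))
end

lemma factorial_mul_treeCoeff_any_le_fN (n : ℕ) :
    (n.factorial : ℝ) * treeCoeff n .any ≤ n * fN n := by
  have h1 := factorial_mul_treeCoeff_le .any (Finset.univ : Finset (Fin n))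
  have h2 : ((rootedTrees .any (Finset.univ : Finset (Fin n))).card : ℝ) ≤
      ((Fintype.card (Fin n) * fN n : ℕ) : ℝ) := Nat.cast_le.2 card_rootedTrees_any_le
  rw [Finset.card_univ, Fintype.card_fin] at h1
  rw [Fintype.card_fin] at h2
  push_cast at h2
  exact h1.trans h2

lemma factorial_mul_treeCoeff_dom_le_iN (n : ℕ) :
    (n.factorial : ℝ) * treeCoeff n .dom ≤ n * iN n := by
  have h1 := factorial_mul_treeCoeff_le .dom (Finset.univ : Finset (Fin n))
  have h2 : ((rootedTrees .dom (Finset.univ : Finset (Fin n))).card : ℝ) ≤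
      ((Fintype.card (Fin n) * iN n : ℕ) : ℝ) := Nat.cast_le.2 card_rootedTrees_dom_le
  rw [Finset.card_univ, Fintype.card_fin] at h1
  rw [Fintype.card_fin] at h2
  push_cast at h2
  exact h1.trans h2

lemma fN_le (n : ℕ) : (fN n : ℝ) ≤ n.factorial * Real.exp 1 ^ (n + 1) := by
  have h1 : (fN n : ℝ) ≤ ((n + 1 : ℕ) : ℝ) ^ n := by
    have := card_forest_le (V := Fin n)
    rw [Fintype.card_fin] at this
    exact_mod_cast this
  have h2 := Real.pow_div_factorial_le_exp ((n + 1 : ℕ) : ℝ) (by positivity) n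
  rw [div_le_iff₀ (by positivity)] at h2
  rw [← Real.exp_nat_mul, mul_one]
  linarith

lemma exists_iN_le {r s t u : ℝ} (hr : 0 < r)
    (hs : 0 < s) (ht : 0 < t) (hu : 0 < u) (h1 : r * Real.exp (t + u) ≤ s)
    (h2 : r * (Real.exp u * (Real.exp s - 1)) ≤ u) (h3 : r * Real.exp u ≤ t) :
    ∃ K, 0 < K ∧ ∀ n : ℕ, (iN n : ℝ) ≤ K * (n + 1) ^ 2 * n.factorial * r⁻¹ ^ n := by
  refine ⟨Real.exp s * Real.exp u, by positivity, fun n => ?_⟩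
  have := card_forest_mis_mul_pow_le (V := Fin n) hr hs ht hu h1 h2 h3
  rw [Fintype.card_fin, ← le_div_iff₀ (by positivity)] at this
  refine this.trans (le_of_eq ?_)
  rw [inv_pow]
  ring

lemma eventually_mul_pow_mul_pow_le (C : ℝ) (k : ℕ) {p q : ℝ} (hp : 0 < p) (hpq : p < q) :
    ∀ᶠ n : ℕ in atTop, C * (n + 1 : ℝ) ^ k * p ^ n ≤ q ^ n := by
  have h1 : 1 < q / p := (one_lt_div hp).2 hpq
  have h2 := (isLittleO_pow_const_const_pow_of_one_lt (R := ℝ) k h1).comp_tendsto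
    (tendsto_add_atTop_nat 1)
  have hq : 0 < q := hp.trans hpq
  have hc : 0 < (q / p * (|C| + 1))⁻¹ := by positivity
  filter_upwards [h2.bound hc] with n hn
  simp only [Function.comp_apply] at hn
  rw [Real.norm_of_nonneg (by positivity), Real.norm_of_nonneg (by positivity),
    le_inv_mul_iff₀ (by positivity), pow_succ', mul_assoc,
    mul_le_mul_iff_right₀ (by positivity), div_pow] at hn
  push_cast at hn
  have h3 : (|C| + 1) * (n + 1 : ℝ) ^ k ≤ q ^ n / p ^ n := hn
  rw [le_div_iff₀ (by positivity)] at h3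
  refine le_trans ?_ h3
  gcongr
  linarith [le_abs_self C]

lemma tendsto_rpow_inv_of_eventually {x : ℕ → ℝ} {α : ℝ} (hx : ∀ n, 0 ≤ x n) (hα : 0 < α)
    (hlow : ∀ q, 0 < q → q < α → ∀ᶠ n in atTop, q ^ n ≤ x n)
    (hup : ∀ q, α < q → ∀ᶠ n in atTop, x n ≤ q ^ n) :
    Tendsto (fun n : ℕ => x n ^ ((n : ℝ)⁻¹)) atTop (nhds α) := by
  have hroot : ∀ q : ℝ, 0 ≤ q → ∀ n : ℕ, n ≠ 0 → (q ^ n) ^ ((n : ℝ)⁻¹) = q :=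
    fun q hq n hn => Real.pow_rpow_inv_natCast hq hn
  refine tendsto_order.2 ⟨fun a ha => ?_, fun b hb => ?_⟩
  · obtain ⟨q, hq, hqα⟩ := exists_between (max_lt ha hα)
    have hq0 : 0 < q := (le_max_right _ _).trans_lt hq
    filter_upwards [hlow q hq0 hqα, eventually_ne_atTop 0] with n hn hn0
    calc a < q := (le_max_left _ _).trans_lt hq
      _ = (q ^ n) ^ ((n : ℝ)⁻¹) := (hroot q hq0.le n hn0).symm
      _ ≤ _ := Real.rpow_le_rpow (by positivity) hn (by positivity)
  · obtain ⟨q, hq, hqb⟩ := exists_between hb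
    have hq0 : 0 < q := hα.trans hq
    filter_upwards [hup q hq, eventually_ne_atTop 0] with n hn hn0
    calc x n ^ ((n : ℝ)⁻¹) ≤ (q ^ n) ^ ((n : ℝ)⁻¹) :=
          Real.rpow_le_rpow (hx n) hn (by positivity)
      _ = q := hroot q hq0.le n hn0
      _ < b := hqb

lemma eventually_pow_le_of_treeCoeff {x : ℕ → ℝ} {k : TreeKind} {L q : ℝ}
    (h : ∀ n : ℕ, (n.factorial : ℝ) * treeCoeff n k ≤ n * x n)
    (hL : ∀ q, 0 < q → q < L → ∃ c > 0, ∀ n : ℕ, 2 ≤ n → c * q ^ n ≤ treeCoeff n k / 2)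
    (hq : 0 < q) (hqL : q < L) : ∀ᶠ n : ℕ in atTop, n.factorial * q ^ n ≤ x n := by
  obtain ⟨m, hqm, hmL⟩ := exists_between hqL
  obtain ⟨c, hc, hcm⟩ := hL m (hq.trans hqm) hmL
  filter_upwards [eventually_mul_pow_mul_pow_le (1 / (2 * c)) 1 hq hqm, eventually_ge_atTop 2]
    with n hn hn2
  have hn0 : (0 : ℝ) < n := by exact_mod_cast (by omega : 0 < n)
  have h1 : 1 / (2 * c) * (n + 1 : ℝ) ^ 1 * q ^ n * (2 * c) ≤ treeCoeff n k := by
    have := hcm n hn2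
    nlinarith
  have h2 : (n : ℝ) * q ^ n ≤ treeCoeff n k := by
    refine le_trans ?_ h1
    have : 1 / (2 * c) * (n + 1 : ℝ) ^ 1 * q ^ n * (2 * c) = (n + 1) * q ^ n := by
      field_simp
    rw [this]
    gcongr
    linarith
  refine le_of_mul_le_mul_left ((?_ : _ ≤ _).trans (h n)) hn0
  calc (n : ℝ) * (n.factorial * q ^ n) = n.factorial * (n * q ^ n) := by ring
    _ ≤ _ := by gcongr

lemma exists_fN_growth :
    ∃ L : ℝ, Real.exp 1 ≤ L ∧ ∀ q, 0 < q → q < L →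
      ∀ᶠ n : ℕ in atTop, n.factorial * q ^ n ≤ (fN n : ℝ) := by
  have hbd : ∀ n, 2 ≤ n → treeCoeff n .any / 2 ≤ (2 * Real.exp 2) ^ n := fun n hn => by
    have h1 := (factorial_mul_treeCoeff_any_le_fN n).trans
      (mul_le_mul_of_nonneg_left (fN_le n) n.cast_nonneg)
    have h2 : treeCoeff n .any ≤ n * Real.exp 1 ^ (n + 1) := by
      refine le_of_mul_le_mul_left (h1.trans (le_of_eq ?_)) (by positivity : (0 : ℝ) < n.factorial)
      ring
    have h3 : (n : ℝ) ≤ 2 ^ n := by exact_mod_cast Nat.lt_two_pow_self.le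
    have h4 : Real.exp 1 ^ (n + 1) ≤ Real.exp 2 ^ n := by
      rw [← Real.exp_nat_mul, ← Real.exp_nat_mul]
      refine Real.exp_le_exp.2 ?_
      have : (2 : ℝ) ≤ n := by exact_mod_cast hn
      push_cast
      linarith
    calc treeCoeff n .any / 2 ≤ treeCoeff n .any := by linarith [treeCoeff_nonneg n .any]
      _ ≤ n * Real.exp 1 ^ (n + 1) := h2
      _ ≤ 2 ^ n * Real.exp 2 ^ n := by gcongr
      _ = _ := (mul_pow _ _ _).symm
  obtain ⟨L, hL, hle, hge⟩ := exists_growth_rate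
    (fun n hn => half_pos (treeCoeff_any_pos (by omega : 1 ≤ n)))
    (fun m n hm hn => treeCoeff_mul_le (k := .any) rfl (by omega) (by omega))
    (by positivity) hbd
  refine ⟨L, ?_, fun q hq hqL =>
    eventually_pow_le_of_treeCoeff factorial_mul_treeCoeff_any_le_fN hge hq hqL⟩
  by_contra! hlt
  obtain ⟨r, hr1, hr2⟩ := exists_between (inv_strictAnti₀ hL hlt)
  have hr : 0 < r := (inv_pos.2 (Real.exp_pos 1)).trans hr1
  obtain ⟨T, hT, hTeq⟩ := exists_any_solution hle hL hr
    (by simpa [hL.ne'] using mul_lt_mul_of_pos_right hr2 hL)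
  have h1 : Real.exp 1 * T ≤ Real.exp T := by
    have := Real.add_one_le_exp (T - 1)
    rw [Real.exp_sub, le_div_iff₀ (Real.exp_pos 1)] at this
    linarith
  have h2 : 1 < r * Real.exp 1 := (inv_lt_iff_one_lt_mul₀ (Real.exp_pos 1)).1 hr1
  nlinarith [mul_le_mul_of_nonneg_left h1 hr.le]

lemma exists_iN_le_const : ∃ K, 0 < K ∧
    ∀ n : ℕ, (iN n : ℝ) ≤ K * (n + 1) ^ 2 * n.factorial * (0.288789 : ℝ)⁻¹ ^ n :=
  exists_iN_le (s := 0.288789 * Real.exp (0.288789 * Real.exp 0.3466 + 0.3466))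
    (t := 0.288789 * Real.exp 0.3466) (u := 0.3466) (by norm_num) (by positivity) (by positivity)
    (by norm_num) le_rfl (by linarith [exp_supersolution rfl]) le_rfl

lemma exists_iN_growth :
    ∃ L : ℝ, (0.288791 : ℝ)⁻¹ ≤ L ∧ L ≤ (0.288789 : ℝ)⁻¹ ∧
      (∀ q, 0 < q → q < L → ∀ᶠ n : ℕ in atTop, n.factorial * q ^ n ≤ (iN n : ℝ)) ∧
      ∀ q, L < q → ∀ᶠ n : ℕ in atTop, (iN n : ℝ) ≤ n.factorial * q ^ n := by
  have hup : ∀ {K r q : ℝ}, 0 < r → r⁻¹ < q →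
      (∀ n : ℕ, (iN n : ℝ) ≤ K * (n + 1) ^ 2 * n.factorial * r⁻¹ ^ n) →
      ∀ᶠ n : ℕ in atTop, (iN n : ℝ) ≤ n.factorial * q ^ n := by
    intro K r q hr hq h
    filter_upwards [eventually_mul_pow_mul_pow_le K 2 (inv_pos.2 hr) hq] with n hn
    refine (h n).trans ?_
    calc K * (n + 1 : ℝ) ^ 2 * n.factorial * r⁻¹ ^ n
        = n.factorial * (K * (n + 1 : ℝ) ^ 2 * r⁻¹ ^ n) := by ring
      _ ≤ _ := by gcongr
  obtain ⟨K, hK, hiN⟩ := exists_iN_le_const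
  have hbd : ∀ n, 2 ≤ n → treeCoeff n .dom / 2 ≤ (max K 1 * 8 * (0.288789 : ℝ)⁻¹) ^ n :=
    fun n hn => by
      have h1 := (factorial_mul_treeCoeff_dom_le_iN n).trans
        (mul_le_mul_of_nonneg_left (hiN n) n.cast_nonneg)
      have h2 : treeCoeff n .dom ≤ K * (n * (n + 1) ^ 2) * (0.288789 : ℝ)⁻¹ ^ n := by
        refine le_of_mul_le_mul_left (h1.trans (le_of_eq ?_))
          (by positivity : (0 : ℝ) < n.factorial)
        ring
      have h3 : (n + 1 : ℝ) ≤ 2 ^ n := by exact_mod_cast Nat.lt_two_pow_self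
      have h4 : K ≤ max K 1 ^ n := (le_max_left K 1).trans
        (le_self_pow₀ (le_max_right K 1) (by omega))
      calc treeCoeff n .dom / 2 ≤ treeCoeff n .dom := by linarith [treeCoeff_nonneg n .dom]
        _ ≤ K * (n * (n + 1) ^ 2) * (0.288789 : ℝ)⁻¹ ^ n := h2
        _ ≤ max K 1 ^ n * (2 ^ n * (2 ^ n) ^ 2) * (0.288789 : ℝ)⁻¹ ^ n := by
          gcongr
          linarith
        _ = _ := by
          rw [mul_pow, mul_pow, ← pow_mul, mul_comm n 2, pow_mul, ← mul_pow]
          norm_num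
  obtain ⟨L, hL, hle, hge⟩ := exists_growth_rate
    (fun n hn => half_pos (treeCoeff_dom_pos hn))
    (fun m n hm hn => treeCoeff_mul_le (k := .dom) rfl (by omega) (by omega))
    (by positivity) hbd
  have hlow : ∀ q, 0 < q → q < L → ∀ᶠ n : ℕ in atTop, n.factorial * q ^ n ≤ (iN n : ℝ) :=
    fun q hq hqL => eventually_pow_le_of_treeCoeff factorial_mul_treeCoeff_dom_le_iN hge hq hqL
  refine ⟨L, ?_, ?_, hlow, fun q hq => ?_⟩
  · by_contra! hlt
    have : (0.288791 : ℝ) * L < 1 := by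
      rwa [lt_inv_comm₀ hL (by norm_num), ← one_div, lt_div_iff₀ hL] at hlt
    obtain ⟨A, B, C, hB0, hA, hC, hB⟩ := exists_mis_solution hle hL (by norm_num) this
    exact exp_system_no_solution hB0 hA hC hB
  · by_contra! hlt
    obtain ⟨q, hq1, hq2⟩ := exists_between hlt
    obtain ⟨p, hp1, hp2⟩ := exists_between hq1
    have hp0 : 0 < p := lt_trans (by norm_num) hp1
    have h1 := hlow q (hp0.trans hp2) hq2
    have h2 := hup (by norm_num) hp1 hiN
    obtain ⟨n, hn1, hn2, hn3⟩ := (h1.and (h2.and (eventually_ge_atTop 1))).exists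
    have h3 := le_of_mul_le_mul_left (hn1.trans hn2) (by positivity : (0 : ℝ) < n.factorial)
    exact absurd h3 (not_le.2 (pow_lt_pow_left₀ hp2 hp0.le (by omega)))
  · obtain ⟨p, hp1, hp2⟩ := exists_between hq
    have hp0 : 0 < p := hL.trans hp1
    have hr : 0 < p⁻¹ := inv_pos.2 hp0
    obtain ⟨A, B, C, hB0, hA, hC, hB⟩ := exists_mis_solution hle hL hr
      (by rw [inv_mul_lt_iff₀ hp0]; linarith)
    have hA0 : 0 < A := hA ▸ by positivity
    have hC0 : 0 < C := hC ▸ by positivity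
    have hBeq : B = p⁻¹ * (Real.exp B * (Real.exp A - 1)) := by
      rw [Real.exp_add] at hB
      linarith
    have hB' : 0 < B := by
      rw [hBeq]
      have := Real.add_one_lt_exp hA0.ne'
      exact mul_pos hr (mul_pos (Real.exp_pos B) (by linarith))
    obtain ⟨K, -, hK⟩ := exists_iN_le hr hA0 hC0 hB' (by rw [add_comm C B]; exact hA.ge)
      hBeq.ge hC.ge
    exact hup hr (by rwa [inv_inv]) hK

theorem stmt_9 :
    ∃ α : ℝ, 1.27386 < α ∧ α < 1.27387 ∧
      Tendsto (fun n : ℕ => ((iN n : ℝ) / (fN n : ℝ)) ^ ((n : ℝ)⁻¹))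
        atTop (nhds α) := by
  obtain ⟨M, hM, hf⟩ := exists_fN_growth
  obtain ⟨L, hL1, hL2, hlow, hup⟩ := exists_iN_growth
  have he := Real.exp_pos 1
  have hL : 0 < L := lt_of_lt_of_le (by norm_num) hL1
  refine ⟨L / Real.exp 1, ?_, ?_, tendsto_rpow_inv_of_eventually (fun n => by positivity)
    (by positivity) (fun q hq hqα => ?_) fun q hq => ?_⟩
  · rw [lt_div_iff₀ he]
    have := Real.exp_one_lt_d9
    norm_num at hL1 this ⊢
    linarith
  · rw [div_lt_iff₀ he]
    have := Real.exp_one_gt_d9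
    norm_num at hL2 this ⊢
    linarith
  · rw [lt_div_iff₀ he] at hqα
    obtain ⟨m, hm1, hm2⟩ := exists_between hqα
    have hm0 : 0 < m := lt_trans (by positivity) hm1
    have hd : Real.exp 1 < m / q := (lt_div_iff₀' hq).2 hm1
    have hf0 : ∀ᶠ n : ℕ in atTop, (0 : ℝ) < fN n := by
      filter_upwards [hf 1 one_pos (lt_of_lt_of_le (by linarith [Real.add_one_le_exp 1]) hM)]
        with n hn
      exact lt_of_lt_of_le (by positivity) hn
    filter_upwards [hlow m hm0 hm2, hf0,
      eventually_mul_pow_mul_pow_le (Real.exp 1) 0 he hd] with n hn hn0 hn1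
    rw [le_div_iff₀ hn0]
    calc q ^ n * (fN n : ℝ) ≤ q ^ n * (n.factorial * Real.exp 1 ^ (n + 1)) := by
          gcongr
          exact fN_le n
      _ = q ^ n * (n.factorial * (Real.exp 1 * (n + 1 : ℝ) ^ 0 * Real.exp 1 ^ n)) := by ring
      _ ≤ q ^ n * (n.factorial * (m / q) ^ n) := by gcongr
      _ = n.factorial * m ^ n := by
          rw [div_pow]
          field_simp
      _ ≤ _ := hn
  · have hq0 : 0 < q := lt_trans (by positivity) hq
    rw [div_lt_iff₀ he] at hq
    obtain ⟨m, hm1, hm2⟩ := exists_between hq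
    have hm0 : 0 < m := hL.trans hm1
    have hd : m / q < M := lt_of_lt_of_le ((div_lt_iff₀' hq0).2 hm2) hM
    filter_upwards [hup m hm1, hf (m / q) (by positivity) hd] with n hn hn1
    have hn0 : (0 : ℝ) < fN n := lt_of_lt_of_le (by positivity) hn1
    rw [div_le_iff₀ hn0]
    calc (iN n : ℝ) ≤ n.factorial * m ^ n := hn
      _ = q ^ n * (n.factorial * (m / q) ^ n) := by
          rw [div_pow]
          field_simp
      _ ≤ _ := by gcongr
end

section
/- For each n ≥ 1 let m_n denote the number of pairs (F, M) where F is an acyclic simple graph (forest) on the vertex set Fin n and M is a maximal matching of F, and let f_n denote the number of acyclic simple graphs on Fin n. Then the sequence (m_n / f_n)^{1/n} converges as n → ∞ to a limit β satisfying 1.31307 < β < 1.31309. -/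
open Filter Topology MeasureTheory

/-- `M` is a matching of `G`: a set of edges of `G`, no two distinct
edges of which share a vertex. -/
def IsMatching {V : Type*} (G : SimpleGraph V) (M : Set (Sym2 V)) : Prop :=
  M ⊆ G.edgeSet ∧ ∀ e ∈ M, ∀ f ∈ M, e ≠ f → ∀ v : V, v ∈ e → v ∉ f

/-- `M` is a maximal matching of `G`. -/
def IsMaximalMatching {V : Type*} (G : SimpleGraph V) (M : Set (Sym2 V)) : Prop :=
  IsMatching G M ∧ ∀ M' : Set (Sym2 V), IsMatching G M' → ¬ M ⊂ M'

/-- The pairs `(F, M)` where `F` is a forest (acyclic simple graph) on `Fin n`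
and `M` is a maximal matching of `F`. -/
def MMSpace (n : ℕ) :=
  {p : SimpleGraph (Fin n) × Set (Sym2 (Fin n)) // p.1.IsAcyclic ∧ IsMaximalMatching p.1 p.2}

/-- `mN n` is the number of pairs `(F, M)` where `F` is a forest on `Fin n`
and `M` is a maximal matching of `F`. -/
noncomputable def mN (n : ℕ) : ℕ := Nat.card (MMSpace n)

namespace ForestMatching

section Parent

variable {V : Type*}

/-- A parent map is well-founded if some height function strictly decreases along it. -/
def IsRanked (p : V → Option V) : Prop :=
  ∃ d : V → ℕ, ∀ v w, p v = some w → d w < d v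

/-- The graph joining each vertex to its parent. -/
def parentGraph (p : V → Option V) : SimpleGraph V where
  Adj v w := v ≠ w ∧ (p v = some w ∨ p w = some v)
  symm := ⟨fun _ _ h => ⟨h.1.symm, h.2.symm⟩⟩
  loopless := ⟨fun _ h => h.1 rfl⟩

lemma IsRanked.adj_parent {p : V → Option V} (hp : IsRanked p) {v w : V} (h : p v = some w) :
    (parentGraph p).Adj v w := by
  obtain ⟨d, hd⟩ := hp
  refine ⟨?_, Or.inl h⟩
  rintro rfl
  exact (hd _ _ h).false

lemma IsRanked.isAcyclic {p : V → Option V} (hp : IsRanked p) :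
    (parentGraph p).IsAcyclic := by
  classical
  obtain ⟨d, hd⟩ := hp
  intro u c hc
  obtain ⟨x, hx, hmax⟩ := c.support.toFinset.exists_max_image d ⟨u, by simp⟩
  rw [List.mem_toFinset] at hx
  have hc' : (c.rotate x hx).IsCycle := (SimpleGraph.Walk.isCycle_rotate hx).2 hc
  have key : ∀ y ∈ c.support, (parentGraph p).Adj x y → p x = some y := by
    rintro y hy ⟨-, h | h⟩
    · exact h
    · have h1 := hd _ _ h
      have h2 := hmax y (by simpa using hy)
      omega
  have hmem : ∀ y ∈ (c.rotate x hx).support, y ∈ c.support := fun y hy => by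
    rwa [SimpleGraph.Walk.mem_support_rotate_iff] at hy
  have h1 := key _ (hmem _ ((c.rotate x hx).getVert_mem_support 1))
    ((c.rotate x hx).adj_snd hc'.not_nil)
  have h2 := key _ (hmem _ ((c.rotate x hx).getVert_mem_support _))
    ((c.rotate x hx).adj_penultimate hc'.not_nil).symm
  exact hc'.snd_ne_penultimate (Option.some_injective _ (h1.symm.trans h2))

lemma IsRanked.eq_of_parentGraph_eq {p q : V → Option V} (hp : IsRanked p)
    (hroot : ∀ v, p v = none ↔ q v = none) (hG : parentGraph p = parentGraph q) : p = q := by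
  obtain ⟨d, hd⟩ := id hp
  have key : ∀ n v, d v = n → p v = q v := by
    intro n
    induction n using Nat.strong_induction_on with
    | _ n ih =>
      intro v hv
      cases hpv : p v with
      | none => exact ((hroot v).1 hpv).symm
      | some w =>
        have hadj := hp.adj_parent hpv
        rw [hG] at hadj
        rcases hadj.2 with h | h
        · exact h.symm
        · have hlt := hd _ _ hpv
          have hw := ih (d w) (hv ▸ hlt) w rfl
          rw [h] at hw
          have := hd _ _ hw
          omega
  funext v
  exact key _ v rfl

lemma exists_orientation [Nonempty V] (G : SimpleGraph V) (hG : G.IsAcyclic) :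
    ∃ p : V → Option V, ∀ v w, G.Adj v w ↔ p v = some w ∨ p w = some v := by
  classical
  obtain ⟨T, hGT, -, hT⟩ :=
    SimpleGraph.connected_top.exists_isTree_le_of_le_of_isAcyclic (le_top : G ≤ ⊤) hG
  let r : V := Classical.arbitrary V
  have huniq : ∀ v w w', T.Adj v w → T.Adj v w' → T.dist r v = T.dist r w + 1 →
      T.dist r v = T.dist r w' + 1 → w = w' := by
    intro v w w' h h' hd hd'
    obtain ⟨P, hP, hPl⟩ := hT.connected.exists_path_of_dist r v
    have key : ∀ x, T.Adj v x → T.dist r v = T.dist r x + 1 → x = P.penultimate := by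
      intro x hx hdx
      obtain ⟨Q, hQ, hQl⟩ := hT.connected.exists_path_of_dist r x
      refine hT.isAcyclic.eq_penultimate_of_adj_end hP hx ?_
      refine hT.isAcyclic.mem_support_of_ne_mem_support_of_adj_of_isPath hP hQ hx ?_
      intro hv
      have := SimpleGraph.dist_le (Q.takeUntil v hv)
      have h2 := Q.length_takeUntil_le_length hv
      omega
    rw [key w h hd, key w' h' hd']
  let p : V → Option V := fun v =>
    if h : ∃ w, G.Adj v w ∧ T.dist r v = T.dist r w + 1 then some h.choose else none
  have hp : ∀ v w, p v = some w ↔ G.Adj v w ∧ T.dist r v = T.dist r w + 1 := by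
    intro v w
    simp only [p]
    split_ifs with h
    · have hs := h.choose_spec
      constructor
      · intro he
        rw [Option.some_inj] at he
        rw [← he]; exact hs
      · intro hw
        rw [Option.some_inj]
        exact huniq v _ _ (hGT hs.1) (hGT hw.1) hs.2 hw.2
    · simp only [false_iff]
      exact fun hw => h ⟨w, hw⟩
  refine ⟨p, fun v w => ?_⟩
  rw [hp, hp]
  constructor
  · intro h
    rcases hT.dist_eq_dist_add_one_of_adj r (hGT h) with h1 | h1
    · exact Or.inl ⟨h, h1⟩
    · exact Or.inr ⟨h.symm, h1⟩
  · rintro (h | h)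
    · exact h.1
    · exact h.1.symm

end Parent

section MatrixTree

open Finset Matrix

variable {N X : Type*} [Fintype N] [DecidableEq N]

/-- The matrix `1 - P` of a parent map. -/
def parentMatrix (p : N → Option N) : Matrix N N ℝ :=
  fun v w => (if v = w then 1 else 0) - (if p v = some w then 1 else 0)

lemma parentMatrix_mulVec (p : N → Option N) (x : N → ℝ) (v : N) :
    (parentMatrix p *ᵥ x) v = x v - (p v).elim 0 x := by
  simp only [mulVec, dotProduct, parentMatrix, sub_mul, sum_sub_distrib, ite_mul, one_mul,
    zero_mul]
  congr 1
  · simp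
  · cases p v with
    | none => simp
    | some w => simp

lemma det_parentMatrix_of_isRanked {p : N → Option N} (hp : IsRanked p) :
    (parentMatrix p).det = 1 := by
  obtain ⟨d, hd⟩ := hp
  have hB : (parentMatrix p).BlockTriangular (fun v => OrderDual.toDual (d v)) := by
    intro v w h
    have h : d v < d w := h
    have h1 : v ≠ w := by rintro rfl; exact h.false
    have h2 : p v ≠ some w := fun h2 => by have := hd _ _ h2; omega
    simp [parentMatrix, h1, h2]
  rw [hB.det]
  refine prod_eq_one fun a _ => ?_
  suffices h : (parentMatrix p).toSquareBlock (fun v => OrderDual.toDual (d v)) a = 1 by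
    rw [h, det_one]
  ext ⟨v, hv⟩ ⟨w, hw⟩
  have h2 : p v ≠ some w := fun h2 => by
    have h3 := hd _ _ h2
    have : d v = d w := OrderDual.toDual.injective (hv.trans hw.symm)
    omega
  simp [toSquareBlock, toSquareBlockProp, parentMatrix, h2, one_apply]

lemma det_parentMatrix_of_not_isRanked {p : N → Option N} (hp : ¬ IsRanked p) :
    (parentMatrix p).det = 0 := by
  classical
  let it : ℕ → Option N → Option N := fun n => (fun o => o.bind p)^[n]
  by_cases hall : ∀ v, ∃ n, it n (some v) = none
  · refine (hp ⟨fun v => Nat.find (hall v), fun v w hvw => ?_⟩).elim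
    beta_reduce
    have hspec := Nat.find_spec (hall v)
    obtain ⟨m, hm⟩ : ∃ m, Nat.find (hall v) = m + 1 := by
      refine Nat.exists_eq_succ_of_ne_zero fun h0 => ?_
      rw [h0] at hspec
      simp [it] at hspec
    rw [hm] at hspec ⊢
    refine Nat.lt_succ_of_le (Nat.find_min' _ ?_)
    simpa [it, Function.iterate_succ_apply, hvw] using hspec
  · push Not at hall
    obtain ⟨v₀, hv₀⟩ := hall
    rw [← exists_mulVec_eq_zero_iff]
    refine ⟨fun v => if ∃ n, it n (some v) = none then 0 else 1, ?_, ?_⟩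
    · intro h
      have := congrFun h v₀
      simp only [Pi.zero_apply, ite_eq_left_iff, one_ne_zero, imp_false, not_not] at this
      obtain ⟨n, hn⟩ := this
      exact hv₀ n hn
    · funext v
      rw [parentMatrix_mulVec]
      have hnone : ∀ n, it n none = none := by
        intro n
        induction n with
        | zero => rfl
        | succ n ih => simpa [it, Function.iterate_succ_apply] using ih
      have hstep : (∃ n, it n (some v) = none) ↔ ∃ n, it n (p v) = none := by
        constructor
        · rintro ⟨n, hn⟩
          cases n with
          | zero => simp [it] at hn
          | succ n => exact ⟨n, by simpa [it, Function.iterate_succ_apply] using hn⟩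
        · rintro ⟨n, hn⟩
          exact ⟨n + 1, by simpa [it, Function.iterate_succ_apply] using hn⟩
      cases hpv : p v with
      | none =>
        rw [hpv] at hstep
        simp [hstep.2 ⟨0, rfl⟩]
      | some w =>
        rw [hpv] at hstep
        simp [hstep]

/-- A form of the matrix-tree theorem: ranked choices of parents among the allowed labels `S v`
are counted by the determinant of the reduced Laplacian. -/
lemma card_ranked_eq_det [DecidableEq X] (S : N → Finset X) (f : X → Option N)
    [DecidablePred fun q : N → X => IsRanked fun v => f (q v)] :
    (#{q ∈ Fintype.piFinset S | IsRanked fun v => f (q v)} : ℝ) =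
      (Matrix.of fun v w : N => (if v = w then (#(S v) : ℝ) else 0) -
        (#{x ∈ S v | f x = some w} : ℝ)).det := by
  have hL : (Matrix.of fun v w : N => (if v = w then (#(S v) : ℝ) else 0) -
        (#{x ∈ S v | f x = some w} : ℝ)) = fun v => ∑ x ∈ S v,
        (fun w : N => (if v = w then (1 : ℝ) else 0) - (if f x = some w then 1 else 0)) := by
    ext v w
    simp only [Matrix.of_apply, Finset.sum_apply, sum_sub_distrib, sum_const, nsmul_eq_mul,
      sum_boole]
    congr 1
    split_ifs <;> simp
  have h : det (fun v => ∑ x ∈ S v,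
        (fun w : N => (if v = w then (1 : ℝ) else 0) - (if f x = some w then 1 else 0))) =
      ∑ q ∈ Fintype.piFinset S, (parentMatrix fun v => f (q v)).det :=
    (detRowAlternating (n := N) (R := ℝ)).toMultilinearMap.map_sum_finset
      (fun v (x : X) => fun w : N => (if v = w then (1 : ℝ) else 0) -
        (if f x = some w then 1 else 0)) S
  have key : ∀ q : N → X, (parentMatrix fun v => f (q v)).det =
      if IsRanked fun v => f (q v) then 1 else 0 := by
    intro q
    split_ifs with hq
    · exact det_parentMatrix_of_isRanked hq
    · exact det_parentMatrix_of_not_isRanked hq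
  rw [hL, h, sum_congr rfl fun q _ => key q, sum_boole]

/-- Determinant of a scalar matrix minus a constant matrix. -/
lemma det_scalar_sub_const {a : ℝ} (ha : a ≠ 0) (c : ℝ) :
    (Matrix.of fun v w : N => (if v = w then a else 0) - c).det =
      a ^ Fintype.card N * (1 - Fintype.card N * c / a) := by
  have h : (Matrix.of fun v w : N => (if v = w then a else 0) - c) =
      a • (1 + replicateCol Unit (fun _ : N => -c / a) *
        replicateRow Unit (fun _ : N => (1 : ℝ))) := by
    ext v w
    simp only [of_apply, Matrix.smul_apply, Matrix.add_apply, mul_apply, one_apply,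
      replicateCol_apply, replicateRow_apply, smul_eq_mul]
    simp only [univ_unique, sum_singleton]
    split_ifs <;> field_simp <;> ring
  rw [h, det_smul, det_one_add_replicateCol_mul_replicateRow]
  simp only [dotProduct, one_mul, sum_const, card_univ, nsmul_eq_mul]
  ring

end MatrixTree

section ForestCount

open Finset

lemma fN_le (m : ℕ) : fN (m + 1) ≤ (m + 2) ^ (m + 1) := by
  classical
  choose p hp using fun G : {G : SimpleGraph (Fin (m + 1)) // G.IsAcyclic} =>
    exists_orientation G.1 G.2
  have hinj : Function.Injective p := by
    intro G H h
    ext v w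
    rw [hp, hp, h]
  have h := Nat.card_le_card_of_injective p hinj
  simpa [fN, Nat.card_eq_fintype_card] using h

/-- The label of the node obtained by gluing a root to `Fin m`. -/
def tailNode {m : ℕ} : Fin (m + 1) → Option (Fin m) := Fin.cases none some

@[simp] lemma tailNode_zero {m : ℕ} : tailNode (0 : Fin (m + 1)) = none := rfl

@[simp] lemma tailNode_succ {m : ℕ} (i : Fin m) : tailNode i.succ = some i := rfl

lemma tailNode_eq_some {m : ℕ} {i : Fin (m + 1)} {j : Fin m} :
    tailNode i = some j ↔ i = j.succ := by
  cases i using Fin.cases <;> simp [(Fin.succ_ne_zero _).symm]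

lemma le_fN (m : ℕ) : ((m + 1 : ℕ) : ℝ) ^ m / (m + 1 : ℕ) ≤ fN (m + 1) := by
  classical
  have hdet := card_ranked_eq_det (N := Fin m) (fun _ => (univ : Finset (Fin (m + 1)))) tailNode
  have hc : ∀ w : Fin m, #{x : Fin (m + 1) | tailNode x = some w} = 1 := by
    intro w
    rw [card_eq_one]
    exact ⟨w.succ, by ext; simp [tailNode_eq_some]⟩
  simp only [hc, card_univ, Fintype.card_fin, Nat.cast_one] at hdet
  rw [det_scalar_sub_const (by positivity)] at hdet
  have hval : ((m + 1 : ℕ) : ℝ) ^ m / (m + 1 : ℕ) =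
      ((m + 1 : ℕ) : ℝ) ^ Fintype.card (Fin m) *
        (1 - (Fintype.card (Fin m) : ℝ) * 1 / (m + 1 : ℕ)) := by
    rw [Fintype.card_fin]
    push_cast
    field_simp
    ring
  rw [hval, ← hdet, Nat.cast_le]
  let P : (Fin m → Fin (m + 1)) → Fin (m + 1) → Option (Fin (m + 1)) :=
    fun q => Fin.cases none fun i => some (q i)
  have hP : ∀ q : Fin m → Fin (m + 1), IsRanked (fun v => tailNode (q v)) → IsRanked (P q) := by
    rintro q ⟨d, hd⟩
    refine ⟨Fin.cases 0 fun i => d i + 1, fun v w h => ?_⟩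
    cases v using Fin.cases with
    | zero => simp [P] at h
    | succ i =>
      have h : q i = w := by simpa [P] using h
      cases w using Fin.cases with
      | zero => simp
      | succ k =>
        have := hd i k (by simp [h])
        simpa using this
  let Q := {q ∈ Fintype.piFinset (fun _ : Fin m => (univ : Finset (Fin (m + 1)))) |
    IsRanked fun v => tailNode (q v)}
  let g : Q → {G : SimpleGraph (Fin (m + 1)) // G.IsAcyclic} := fun q =>
    ⟨parentGraph (P q.1), (hP _ (mem_filter.1 q.2).2).isAcyclic⟩
  have hg : Function.Injective g := by
    intro q q' h
    have h1 : parentGraph (P q.1) = parentGraph (P q'.1) := congrArg Subtype.val h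
    have h2 : P q.1 = P q'.1 := by
      refine (hP _ (mem_filter.1 q.2).2).eq_of_parentGraph_eq ?_ h1
      intro v
      cases v using Fin.cases <;> simp [P]
    apply Subtype.ext
    funext i
    have := congrFun h2 i.succ
    simpa [P] using this
  have h := Nat.card_le_card_of_injective g hg
  rwa [Nat.card_eq_fintype_card, Fintype.card_coe] at h

end ForestCount

section MatchedTrees

open Finset Matrix

/-- Vertices of a graph with `k` matched edges and `u` unmatched vertices: the child and the parent
end of each matched edge, then the unmatched vertices. -/
abbrev MatchedVertex (k u : ℕ) := Fin k ⊕ Fin k ⊕ Fin u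

/-- The vertices covered by the matching. -/
def coveredVertices (k u : ℕ) : Finset (MatchedVertex k u) :=
  univ.disjSum (univ.disjSum ∅)

lemma card_coveredVertices (k u : ℕ) : #(coveredVertices k u) = 2 * k := by
  simp [coveredVertices, two_mul]

lemma inr_inr_notMem_coveredVertices {k u : ℕ} (c : Fin u) :
    (Sum.inr (Sum.inr c) : MatchedVertex k u) ∉ coveredVertices k u := by
  simp [coveredVertices]

/-- The node of a vertex once the matched edges are contracted; the first edge is the root. -/
def contractedNode {j u : ℕ} : MatchedVertex (j + 1) u → Option (Fin j ⊕ Fin u)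
  | .inl a => (tailNode a).map Sum.inl
  | .inr (.inl b) => (tailNode b).map Sum.inl
  | .inr (.inr c) => some (Sum.inr c)

/-- The vertices to which a node may be attached. -/
def allowedParents (j u : ℕ) : Fin j ⊕ Fin u → Finset (MatchedVertex (j + 1) u)
  | .inl _ => univ
  | .inr _ => coveredVertices (j + 1) u

open Classical in
/-- Ranked choices of attachment vertices for all nodes but the root. -/
noncomputable def attachments (j u : ℕ) : Finset (Fin j ⊕ Fin u → MatchedVertex (j + 1) u) :=
  {q ∈ Fintype.piFinset (allowedParents j u) | IsRanked fun v => contractedNode (q v)}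

lemma card_attachments (j u : ℕ) :
    (#(attachments j u) : ℝ) =
      (2 * (j + 1)) ^ u * (2 * (j + 1) + u) ^ j / (j + 1) := by
  classical
  have hn : (0 : ℝ) < 2 * (j + 1) + u := by positivity
  have hk : (2 * (j + 1) : ℝ) ≠ 0 := by positivity
  have hinl : ∀ w : Fin j, ∀ x : MatchedVertex (j + 1) u, contractedNode x = some (Sum.inl w) ↔
      x ∈ ({.inl w.succ, .inr (.inl w.succ)} : Finset (MatchedVertex (j + 1) u)) := by
    rintro w (a | b | c) <;> simp [contractedNode, tailNode_eq_some]
  have hinr : ∀ w : Fin u, ∀ x : MatchedVertex (j + 1) u, contractedNode x = some (Sum.inr w) ↔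
      x = .inr (.inr w) := by
    rintro w (a | b | c) <;> simp [contractedNode]
  have hcard : (Fintype.card (MatchedVertex (j + 1) u) : ℝ) = 2 * (j + 1) + u := by
    simp; ring
  have h := card_ranked_eq_det (allowedParents j u) contractedNode
  have hL : (Matrix.of fun v w : Fin j ⊕ Fin u =>
      (if v = w then (#(allowedParents j u v) : ℝ) else 0) -
        (#{x ∈ allowedParents j u v | contractedNode x = some w} : ℝ)) =
      fromBlocks (Matrix.of fun v w : Fin j => (if v = w then (2 * (j + 1) + u : ℝ) else 0) - 2)
        (Matrix.of fun _ _ => -1) (Matrix.of fun _ _ => -2)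
        ((2 * (j + 1) : ℝ) • (1 : Matrix (Fin u) (Fin u) ℝ)) := by
    ext (v | v) (w | w)
    · have : {x ∈ allowedParents j u (.inl v) | contractedNode x = some (.inl w)} =
          {.inl w.succ, .inr (.inl w.succ)} := by
        ext x; simp only [mem_filter, hinl]; simp [allowedParents]
      rw [of_apply, this, fromBlocks_apply₁₁, of_apply, card_pair (by simp)]
      simp [allowedParents, ← hcard]
    · have : {x ∈ allowedParents j u (.inl v) | contractedNode x = some (.inr w)} =
          {.inr (.inr w)} := by
        ext x; simp only [mem_filter, hinr]; simp [allowedParents]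
      simp [this]
    · have : {x ∈ allowedParents j u (.inr v) | contractedNode x = some (.inl w)} =
          {.inl w.succ, .inr (.inl w.succ)} := by
        ext x; simp only [mem_filter, hinl]
        refine and_iff_right_of_imp fun hx => ?_
        simp only [mem_insert, mem_singleton] at hx
        rcases hx with rfl | rfl <;> simp [allowedParents, coveredVertices]
      simp [this]
    · have : {x ∈ allowedParents j u (.inr v) | contractedNode x = some (.inr w)} = ∅ := by
        ext x; simp only [mem_filter, hinr]
        simp only [notMem_empty, iff_false, not_and]
        rintro hx rfl
        exact inr_inr_notMem_coveredVertices _ hx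
      rw [of_apply, this]
      simp [allowedParents, card_coveredVertices, one_apply]
  let inv : Invertible ((2 * (j + 1) : ℝ) • (1 : Matrix (Fin u) (Fin u) ℝ)) :=
    ⟨(2 * (j + 1) : ℝ)⁻¹ • 1, by rw [smul_mul_smul_comm, inv_mul_cancel₀ hk, mul_one, one_smul],
      by rw [smul_mul_smul_comm, mul_inv_cancel₀ hk, mul_one, one_smul]⟩
  rw [hL, det_fromBlocks₂₂] at h
  have hinv : ⅟((2 * (j + 1) : ℝ) • (1 : Matrix (Fin u) (Fin u) ℝ)) =
    (2 * (j + 1) : ℝ)⁻¹ • 1 := rfl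
  have hS : (Matrix.of fun v w : Fin j => (if v = w then (2 * (j + 1) + u : ℝ) else 0) - 2) -
      (Matrix.of fun (_ : Fin j) (_ : Fin u) => (-1 : ℝ)) *
        ⅟((2 * (j + 1) : ℝ) • (1 : Matrix (Fin u) (Fin u) ℝ)) *
        (Matrix.of fun (_ : Fin u) (_ : Fin j) => (-2 : ℝ)) =
      Matrix.of fun v w : Fin j => (if v = w then (2 * (j + 1) + u : ℝ) else 0) -
        (2 + u / (j + 1)) := by
    rw [hinv, Matrix.mul_smul, Matrix.mul_one, Matrix.smul_mul]
    ext v w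
    simp only [Matrix.sub_apply, of_apply,
      Matrix.smul_apply, mul_apply, smul_eq_mul, sum_const, card_univ, Fintype.card_fin,
      nsmul_eq_mul]
    field_simp
    ring
  rw [hS, det_scalar_sub_const hn.ne', det_smul, det_one] at h
  unfold attachments
  rw [h]
  simp only [Fintype.card_fin]
  field_simp
  ring

end MatchedTrees

section MaximalMatching

lemma isMaximalMatching_iff {V : Type*} {G : SimpleGraph V} {M : Set (Sym2 V)}
    (hM : IsMatching G M) :
    IsMaximalMatching G M ↔ ∀ v w, G.Adj v w → ∃ e ∈ M, v ∈ e ∨ w ∈ e := by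
  constructor
  · rintro ⟨-, hmax⟩ v w hvw
    by_contra! hno
    refine hmax (insert s(v, w) M) ⟨?_, ?_⟩ ⟨Set.subset_insert _ _, fun h => ?_⟩
    · exact Set.insert_subset hvw hM.1
    · rintro e (rfl | he) f (rfl | hf) hef x hxe hxf
      · exact hef rfl
      · rcases Sym2.mem_iff.1 hxe with rfl | rfl
        · exact (hno f hf).1 hxf
        · exact (hno f hf).2 hxf
      · rcases Sym2.mem_iff.1 hxf with rfl | rfl
        · exact (hno e he).1 hxe
        · exact (hno e he).2 hxe
      · exact hM.2 e he f hf hef x hxe hxf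
    · exact (hno _ (h (Set.mem_insert _ _))).1 (Sym2.mem_mk_left v w)
  · intro h
    refine ⟨hM, fun M' hM' hlt => ?_⟩
    obtain ⟨e, he', he⟩ := Set.exists_of_ssubset hlt
    induction e using Sym2.ind with
    | _ v w =>
      obtain ⟨f, hf, hvf | hwf⟩ := h v w (hM'.1 he')
      · exact hM'.2 _ he' f (hlt.1 hf) (fun hef => he (hef ▸ hf)) v (Sym2.mem_mk_left v w) hvf
      · exact hM'.2 _ he' f (hlt.1 hf) (fun hef => he (hef ▸ hf)) w (Sym2.mem_mk_right v w) hwf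

instance (n : ℕ) : Finite (MMSpace n) := Subtype.finite

end MaximalMatching

section LowerBound

open Finset

variable {V : Type*} {j k u : ℕ}

/-- The parent map of a tree on the matched vertices built from attachments of the nodes. -/
def matchedParent (q : Fin j ⊕ Fin u → MatchedVertex (j + 1) u) :
    MatchedVertex (j + 1) u → Option (MatchedVertex (j + 1) u)
  | .inl a => some (.inr (.inl a))
  | .inr (.inl b) => (tailNode b).map fun i => q (.inl i)
  | .inr (.inr c) => some (q (.inr c))

lemma matchedParent_injective :
    Function.Injective (matchedParent : (Fin j ⊕ Fin u → MatchedVertex (j + 1) u) → _) := by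
  intro q q' h
  funext v
  rcases v with i | c
  · simpa [matchedParent] using congrFun h (.inr (.inl i.succ))
  · simpa [matchedParent] using congrFun h (.inr (.inr c))

lemma matchedParent_eq_none {q : Fin j ⊕ Fin u → MatchedVertex (j + 1) u}
    {v : MatchedVertex (j + 1) u} : matchedParent q v = none ↔ v = .inr (.inl 0) := by
  rcases v with a | b | c
  · simp [matchedParent]
  · cases b using Fin.cases <;> simp [matchedParent]
  · simp [matchedParent]

lemma isRanked_matchedParent {q : Fin j ⊕ Fin u → MatchedVertex (j + 1) u}
    (hq : IsRanked fun v => contractedNode (q v)) : IsRanked (matchedParent q) := by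
  obtain ⟨d, hd⟩ := hq
  let h : Option (Fin j ⊕ Fin u) → ℕ := fun o => o.elim 0 fun v => 2 * d v + 2
  let D : MatchedVertex (j + 1) u → ℕ := fun w =>
    match w with
    | .inl a => h (contractedNode (.inl a)) + 1
    | .inr x => h (contractedNode (.inr x))
  have hD : ∀ w, D w ≤ h (contractedNode w) + 1 := by
    rintro (a | x)
    · exact le_rfl
    · exact Nat.le_succ _
  have hlt : ∀ v, D (q v) < 2 * d v + 2 := by
    intro v
    have h1 := hD (q v)
    cases hc : contractedNode (q v) with
    | none =>
      rw [hc] at h1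
      simp only [h, Option.elim] at h1
      omega
    | some w =>
      rw [hc] at h1
      have := hd v w hc
      simp only [h, Option.elim] at h1
      omega
  refine ⟨D, fun v w hvw => ?_⟩
  rcases v with a | b | c
  · obtain rfl : Sum.inr (Sum.inl a) = w := by simpa [matchedParent] using hvw
    simp [D, contractedNode]
  · cases b using Fin.cases with
    | zero => simp [matchedParent] at hvw
    | succ i =>
      obtain rfl : q (.inl i) = w := by simpa [matchedParent] using hvw
      simpa [D, contractedNode, h] using hlt (.inl i)
  · obtain rfl : q (.inr c) = w := by simpa [matchedParent] using hvw
    simpa [D, contractedNode, h] using hlt (.inr c)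

/-- Transport of a parent map along a relabelling. -/
def relabel {W : Type*} (σ : W ≃ V) (p : W → Option W) : V → Option V :=
  fun v => (p (σ.symm v)).map σ

lemma relabel_apply {W : Type*} (σ : W ≃ V) (p : W → Option W) (w : W) :
    relabel σ p (σ w) = (p w).map σ := by
  simp [relabel]

lemma relabel_injective {W : Type*} (σ : W ≃ V) : Function.Injective (relabel σ) := by
  intro p p' h
  funext w
  have := congrFun h (σ w)
  rw [relabel_apply, relabel_apply] at this
  exact Option.map_injective σ.injective this

lemma IsRanked.relabel {W : Type*} (σ : W ≃ V) {p : W → Option W} (hp : IsRanked p) :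
    IsRanked (relabel σ p) := by
  obtain ⟨d, hd⟩ := hp
  refine ⟨fun v => d (σ.symm v), fun v w h => ?_⟩
  obtain ⟨x, hx, rfl⟩ := Option.map_eq_some_iff.1 h
  simpa using hd _ _ hx

/-- The matching carried over from the standard one along a labelling. -/
def labelledMatching (σ : MatchedVertex k u ≃ V) : Set (Sym2 V) :=
  Set.range fun i : Fin k => s(σ (.inl i), σ (.inr (.inl i)))

lemma isMaximalMatching_labelledMatching (σ : MatchedVertex (j + 1) u ≃ V)
    {q : Fin j ⊕ Fin u → MatchedVertex (j + 1) u} (hq : q ∈ attachments j u) :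
    IsMaximalMatching (parentGraph (relabel σ (matchedParent q))) (labelledMatching σ) := by
  classical
  obtain ⟨hqS, hqr⟩ := mem_filter.1 hq
  have hr := (isRanked_matchedParent hqr).relabel σ
  have hM : IsMatching (parentGraph (relabel σ (matchedParent q))) (labelledMatching σ) := by
    refine ⟨?_, ?_⟩
    · rintro _ ⟨i, rfl⟩
      exact hr.adj_parent (by rw [relabel_apply]; rfl)
    · rintro _ ⟨i, rfl⟩ _ ⟨i', rfl⟩ hne v hv hv'
      refine hne ?_
      simp only [Sym2.mem_iff] at hv hv'
      rcases hv with rfl | rfl <;> rcases hv' with h | h <;> simp_all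
  rw [isMaximalMatching_iff hM]
  have hcov : ∀ x ∈ coveredVertices (j + 1) u, ∃ e ∈ labelledMatching σ, σ x ∈ e := by
    rintro (a | b | c) hx
    · exact ⟨_, ⟨a, rfl⟩, Sym2.mem_mk_left _ _⟩
    · exact ⟨_, ⟨b, rfl⟩, Sym2.mem_mk_right _ _⟩
    · exact (inr_inr_notMem_coveredVertices c hx).elim
  have key : ∀ v w, relabel σ (matchedParent q) v = some w →
      ∃ e ∈ labelledMatching σ, v ∈ e ∨ w ∈ e := by
    intro v w h
    obtain ⟨x, rfl⟩ := σ.surjective v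
    rw [relabel_apply] at h
    rcases x with a | b | c
    · exact ⟨_, ⟨a, rfl⟩, Or.inl (Sym2.mem_mk_left _ _)⟩
    · exact ⟨_, ⟨b, rfl⟩, Or.inl (Sym2.mem_mk_right _ _)⟩
    · obtain rfl : σ (q (.inr c)) = w := by simpa [matchedParent] using h
      obtain ⟨e, he, hx⟩ := hcov (q (.inr c)) (Fintype.mem_piFinset.1 hqS (.inr c))
      exact ⟨e, he, Or.inr hx⟩
  rintro v w ⟨-, h | h⟩
  · exact key v w h
  · obtain ⟨e, he, hx⟩ := key w v h
    exact ⟨e, he, hx.symm⟩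

/-- Labellings with the same parent map and matching differ by a permutation of the matched edges
and one of the unmatched vertices. -/
lemma exists_perm_of_labelledMatching_eq {σ σ' : MatchedVertex (j + 1) u ≃ V}
    {q q' : Fin j ⊕ Fin u → MatchedVertex (j + 1) u}
    (hr : IsRanked (relabel σ (matchedParent q)))
    (hp : relabel σ (matchedParent q) = relabel σ' (matchedParent q'))
    (hM : labelledMatching σ = labelledMatching σ') :
    ∃ τρ : Equiv.Perm (Fin (j + 1)) × Equiv.Perm (Fin u),
      ∀ w, σ' w = σ (Sum.map τρ.1 (Sum.map τρ.1 τρ.2) w) := by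
  obtain ⟨d, hd⟩ := hr
  have h1 : ∀ i, ∃ i', σ' (.inl i) = σ (.inl i') ∧ σ' (.inr (.inl i)) = σ (.inr (.inl i')) := by
    intro i
    have hi : s(σ' (.inl i), σ' (.inr (.inl i))) ∈ labelledMatching σ := hM ▸ ⟨i, rfl⟩
    obtain ⟨i', hi'⟩ := hi
    rcases Sym2.eq_iff.1 hi' with ⟨ha, hb⟩ | ⟨ha, hb⟩
    · exact ⟨i', ha.symm, hb.symm⟩
    · exfalso
      have e1 : relabel σ (matchedParent q) (σ (.inl i')) = some (σ (.inr (.inl i'))) := by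
        rw [relabel_apply]; rfl
      have e2 : relabel σ (matchedParent q) (σ' (.inl i)) = some (σ' (.inr (.inl i))) := by
        rw [hp, relabel_apply]; rfl
      have d1 := hd _ _ e1
      have d2 := hd _ _ e2
      rw [ha, hb] at d1
      omega
  choose t ht ht' using h1
  have htinj : Function.Injective t := by
    intro a b hab
    have : σ' (.inl a) = σ' (.inl b) := by rw [ht, ht, hab]
    simpa using this
  have htbij := Finite.injective_iff_bijective.1 htinj
  have h2 : ∀ c, ∃ c', σ' (.inr (.inr c)) = σ (.inr (.inr c')) := by
    intro c
    obtain ⟨x, hx⟩ := σ.surjective (σ' (.inr (.inr c)))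
    rcases x with a | b | c'
    · obtain ⟨i, rfl⟩ := htbij.2 a
      rw [← ht] at hx
      simp at hx
    · obtain ⟨i, rfl⟩ := htbij.2 b
      rw [← ht'] at hx
      simp at hx
    · exact ⟨c', hx.symm⟩
  choose s hs using h2
  have hsinj : Function.Injective s := by
    intro a b hab
    have : σ' (.inr (.inr a)) = σ' (.inr (.inr b)) := by rw [hs, hs, hab]
    simpa using this
  refine ⟨(Equiv.ofBijective t htbij,
    Equiv.ofBijective s (Finite.injective_iff_bijective.1 hsinj)), ?_⟩
  rintro (a | b | c)
  · exact ht a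
  · exact ht' b
  · exact hs c

lemma le_mN {n : ℕ} (hn : n = 2 * (j + 1) + u) :
    n.factorial * #(attachments j u) ≤
      mN n * n * ((j + 1).factorial * u.factorial) := by
  classical
  have hcard : Fintype.card (MatchedVertex (j + 1) u) = Fintype.card (Fin n) := by
    simp [hn]; ring
  let e : MatchedVertex (j + 1) u ≃ Fin n := Fintype.equivOfCardEq hcard
  let D := (MatchedVertex (j + 1) u ≃ Fin n) × attachments j u
  have hr : ∀ x : D, IsRanked (relabel x.1 (matchedParent x.2.1)) := fun x =>
    (isRanked_matchedParent (mem_filter.1 x.2.2).2).relabel x.1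
  let Φ : D → MMSpace n × Fin n := fun x =>
    (⟨(parentGraph (relabel x.1 (matchedParent x.2.1)), labelledMatching x.1),
      (hr x).isAcyclic, isMaximalMatching_labelledMatching x.1 x.2.2⟩, x.1 (.inr (.inl 0)))
  have hΦ : ∀ x y : D, Φ x = Φ y →
      relabel x.1 (matchedParent x.2.1) = relabel y.1 (matchedParent y.2.1) ∧
      labelledMatching x.1 = labelledMatching y.1 := by
    intro x y h
    obtain ⟨h1, h2⟩ := Prod.ext_iff.1 h
    obtain ⟨h3, h4⟩ := Prod.ext_iff.1 (congrArg Subtype.val h1)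
    refine ⟨(hr x).eq_of_parentGraph_eq (fun v => ?_) h3, h4⟩
    have h2 : x.1 (.inr (.inl 0)) = y.1 (.inr (.inl 0)) := h2
    simp only [relabel, Option.map_eq_none_iff, matchedParent_eq_none, Equiv.symm_apply_eq, h2]
  rcases isEmpty_or_nonempty D with hD | hD
  · have h0 : Nat.card D = 0 := Nat.card_of_isEmpty
    have : Nat.card D = n.factorial * #(attachments j u) := by
      rw [Nat.card_prod, Nat.card_eq_fintype_card, Fintype.card_equiv e, hcard,
        Fintype.card_fin, Nat.card_eq_fintype_card, Fintype.card_coe]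
    omega
  have hex : ∀ x : D, ∃ τρ : Equiv.Perm (Fin (j + 1)) × Equiv.Perm (Fin u),
      ∀ w, x.1 w = (Function.invFun Φ (Φ x)).1 (Sum.map τρ.1 (Sum.map τρ.1 τρ.2) w) := by
    intro x
    obtain ⟨h1, h2⟩ := hΦ _ _ (Function.invFun_eq (f := Φ) (b := Φ x) ⟨x, rfl⟩)
    exact exists_perm_of_labelledMatching_eq (hr _) h1 h2
  choose τρ hτρ using hex
  have hinj : Function.Injective fun x : D => (Φ x, τρ x) := by
    intro x y h
    obtain ⟨h1, h2⟩ := Prod.ext_iff.1 h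
    have h1 : Φ x = Φ y := h1
    have h2 : τρ x = τρ y := h2
    have hσ : x.1 = y.1 := by
      ext w
      rw [hτρ x, hτρ y, h1, h2]
    refine Prod.ext hσ (Subtype.ext ?_)
    have h3 := (hΦ x y h1).1
    rw [hσ] at h3
    exact matchedParent_injective (relabel_injective _ h3)
  have h := Nat.card_le_card_of_injective _ hinj
  rw [Nat.card_prod, Nat.card_eq_fintype_card, Fintype.card_equiv e, hcard,
    Fintype.card_fin, Nat.card_eq_fintype_card, Fintype.card_coe, Nat.card_prod, Nat.card_prod,
    Nat.card_prod] at h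
  simpa [Nat.card_eq_fintype_card, Fintype.card_perm, mN] using h

end LowerBound

section UpperBound

open Finset

variable {V : Type*} {k u : ℕ}

/-- The labelling `σ` exhibits `M` as a matching oriented by `p`, with no unmatched vertex having
an unmatched parent. -/
structure IsAdapted (σ : MatchedVertex k u ≃ V) (p : V → Option V) (M : Set (Sym2 V)) : Prop where
  matching_eq : M = labelledMatching σ
  parent_inl : ∀ i, p (σ (.inl i)) = some (σ (.inr (.inl i)))
  parent_inr_inr : ∀ c c', p (σ (.inr (.inr c))) ≠ some (σ (.inr (.inr c')))

lemma IsAdapted.perm {σ : MatchedVertex k u ≃ V} {p : V → Option V} {M : Set (Sym2 V)}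
    (h : IsAdapted σ p M) (τ : Equiv.Perm (Fin k)) (ρ : Equiv.Perm (Fin u)) :
    IsAdapted ((Equiv.sumCongr τ (Equiv.sumCongr τ ρ)).trans σ) p M where
  matching_eq := by
    rw [h.matching_eq]
    exact (τ.surjective.range_comp fun i => s(σ (.inl i), σ (.inr (.inl i)))).symm
  parent_inl i := h.parent_inl (τ i)
  parent_inr_inr c c' := h.parent_inr_inr (ρ c) (ρ c')

lemma exists_isAdapted [Finite V] {G : SimpleGraph V} {M : Set (Sym2 V)}
    (hM : IsMaximalMatching G M) {p : V → Option V}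
    (hp : ∀ v w, G.Adj v w ↔ p v = some w ∨ p w = some v) :
    ∃ (k u : ℕ) (σ : MatchedVertex k u ≃ V), IsAdapted σ p M := by
  classical
  have hex : ∀ e : M, ∃ a b, e.1 = s(a, b) ∧ p a = some b := by
    rintro ⟨e, he⟩
    induction e using Sym2.ind with
    | _ v w =>
      rcases (hp v w).1 (hM.1.1 he) with h | h
      · exact ⟨v, w, rfl, h⟩
      · exact ⟨w, v, Sym2.eq_swap, h⟩
  choose a b hab hpab using hex
  have ha : ∀ e : M, a e ∈ e.1 := fun e => by rw [hab e]; exact Sym2.mem_mk_left _ _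
  have hb : ∀ e : M, b e ∈ e.1 := fun e => by rw [hab e]; exact Sym2.mem_mk_right _ _
  have hne : ∀ e : M, a e ≠ b e := fun e =>
    SimpleGraph.Adj.ne (G := G) ((hp _ _).2 (Or.inl (hpab e)))
  have hdisj : ∀ (e f : M) (v : V), v ∈ e.1 → v ∈ f.1 → e = f := by
    intro e f v he hf
    by_contra hef
    exact hM.1.2 e.1 e.2 f.1 f.2 (fun h => hef (Subtype.ext h)) v he hf
  let ψ : M ⊕ M ⊕ {v : V // ∀ e ∈ M, v ∉ e} → V := Sum.elim a (Sum.elim b Subtype.val)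
  have hψ : Function.Bijective ψ := by
    constructor
    · rintro (e | e | ⟨v, hv⟩) (f | f | ⟨w, hw⟩) h
      · rw [hdisj e f (a e) (ha e) (by rw [show a e = a f from h]; exact ha f)]
      · have h : a e = b f := h
        obtain rfl := hdisj e f (a e) (ha e) (h ▸ hb f)
        exact (hne e h).elim
      · have h : a e = w := h
        exact (hw _ e.2 (h ▸ ha e)).elim
      · have h : b e = a f := h
        obtain rfl := hdisj e f (b e) (hb e) (h ▸ ha f)
        exact (hne e h.symm).elim
      · rw [hdisj e f (b e) (hb e) (by rw [show b e = b f from h]; exact hb f)]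
      · have h : b e = w := h
        exact (hw _ e.2 (h ▸ hb e)).elim
      · have h : v = a f := h
        exact (hv _ f.2 (h ▸ ha f)).elim
      · have h : v = b f := h
        exact (hv _ f.2 (h ▸ hb f)).elim
      · obtain rfl : v = w := h
        rfl
    · intro v
      by_cases hv : ∀ e ∈ M, v ∉ e
      · exact ⟨.inr (.inr ⟨v, hv⟩), rfl⟩
      · push Not at hv
        obtain ⟨e, he, hve⟩ := hv
        have hve : v ∈ s(a ⟨e, he⟩, b ⟨e, he⟩) := by rwa [← hab ⟨e, he⟩]
        rcases Sym2.mem_iff.1 hve with h | h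
        · exact ⟨.inl ⟨e, he⟩, h.symm⟩
        · exact ⟨.inr (.inl ⟨e, he⟩), h.symm⟩
  let e₁ := Finite.equivFin M
  let e₂ := Finite.equivFin {v : V // ∀ e ∈ M, v ∉ e}
  refine ⟨_, _, (Equiv.sumCongr e₁.symm (Equiv.sumCongr e₁.symm e₂.symm)).trans
    (Equiv.ofBijective ψ hψ), ?_, fun i => hpab (e₁.symm i), fun c c' h => ?_⟩
  · ext e
    constructor
    · intro he
      refine ⟨e₁ ⟨e, he⟩, ?_⟩
      change s(a (e₁.symm (e₁ ⟨e, he⟩)), b (e₁.symm (e₁ ⟨e, he⟩))) = e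
      rw [Equiv.symm_apply_apply]
      exact (hab ⟨e, he⟩).symm
    · rintro ⟨i, rfl⟩
      have := (e₁.symm i).2
      rw [hab] at this
      exact this
  · have hadj := (hp _ _).2 (Or.inl h)
    obtain ⟨e, he, hv | hv⟩ := (isMaximalMatching_iff hM.1).1 hM _ _ hadj
    · exact (e₂.symm c).2 e he hv
    · exact (e₂.symm c').2 e he hv

/-- The covered vertex labelled by `x`, if any. -/
def coveredLabel : MatchedVertex k u → Option (Fin k ⊕ Fin k)
  | .inl a => some (.inl a)
  | .inr (.inl b) => some (.inr b)
  | .inr (.inr _) => none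

lemma coveredLabel_eq {x y : MatchedVertex k u} (h : coveredLabel x = coveredLabel y)
    (hx : ∀ c, x ≠ .inr (.inr c)) : x = y := by
  rcases x with a | a | a <;> rcases y with b | b | b <;> simp_all [coveredLabel]

lemma IsAdapted.ext {σ : MatchedVertex k u ≃ V} {p p' : V → Option V} {M M' : Set (Sym2 V)}
    (h : IsAdapted σ p M) (h' : IsAdapted σ p' M')
    (hB : ∀ i, p (σ (.inr (.inl i))) = p' (σ (.inr (.inl i))))
    (hC : ∀ c, (p (σ (.inr (.inr c)))).bind (fun w => coveredLabel (σ.symm w)) =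
      (p' (σ (.inr (.inr c)))).bind (fun w => coveredLabel (σ.symm w))) :
    p = p' ∧ M = M' := by
  refine ⟨?_, h.matching_eq.trans h'.matching_eq.symm⟩
  funext v
  obtain ⟨x, rfl⟩ := σ.surjective v
  rcases x with i | i | c
  · rw [h.parent_inl, h'.parent_inl]
  · exact hB i
  · have hc := hC c
    have h1 := h.parent_inr_inr c
    have h2 := h'.parent_inr_inr c
    have key : ∀ w, (∀ c', some w ≠ some (σ (.inr (.inr c')))) →
        ∀ c', σ.symm w ≠ .inr (.inr c') := by
      intro w hw c' he
      exact hw c' (by rw [← he, Equiv.apply_symm_apply])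
    cases hpv : p (σ (.inr (.inr c))) with
    | none =>
      cases hpv' : p' (σ (.inr (.inr c))) with
      | none => rfl
      | some w' =>
        rw [hpv'] at h2
        rw [hpv, hpv'] at hc
        have hk := key w' h2
        simp only [Option.bind_none, Option.bind_some] at hc
        cases hx : σ.symm w' with
        | inl a => simp [hx, coveredLabel] at hc
        | inr y =>
          cases y with
          | inl b => simp [hx, coveredLabel] at hc
          | inr c' => exact (hk c' hx).elim
    | some w =>
      rw [hpv] at h1
      have hk := key w h1
      cases hpv' : p' (σ (.inr (.inr c))) with
      | none =>
        rw [hpv, hpv'] at hc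
        simp only [Option.bind_none, Option.bind_some] at hc
        cases hx : σ.symm w with
        | inl a => simp [hx, coveredLabel] at hc
        | inr y =>
          cases y with
          | inl b => simp [hx, coveredLabel] at hc
          | inr c' => exact (hk c' hx).elim
      | some w' =>
        rw [hpv, hpv'] at hc
        simp only [Option.bind_some] at hc
        rw [σ.symm.injective (coveredLabel_eq hc hk)]

lemma card_isAdapted_mul_le {n : ℕ} (p : MMSpace n → Fin n → Option (Fin n))
    (hp : ∀ x v w, x.1.1.Adj v w ↔ p x v = some w ∨ p x w = some v) (k u : ℕ) :
    Nat.card {x : MMSpace n // ∃ σ : MatchedVertex k u ≃ Fin n, IsAdapted σ (p x) x.1.2} *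
      (k.factorial * u.factorial) ≤ n.factorial * ((n + 1) ^ k * (2 * k + 1) ^ u) := by
  classical
  rcases isEmpty_or_nonempty
    {x : MMSpace n // ∃ σ : MatchedVertex k u ≃ Fin n, IsAdapted σ (p x) x.1.2} with hE | ⟨⟨x₀⟩⟩
  · simp
  obtain ⟨e, -⟩ := x₀.2
  choose σ hσ using fun x :
    {x : MMSpace n // ∃ σ : MatchedVertex k u ≃ Fin n, IsAdapted σ (p x) x.1.2} => x.2
  let lab : {x : MMSpace n // ∃ σ : MatchedVertex k u ≃ Fin n, IsAdapted σ (p x) x.1.2} ×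
      Equiv.Perm (Fin k) × Equiv.Perm (Fin u) → (MatchedVertex k u ≃ Fin n) := fun y =>
    (Equiv.sumCongr y.2.1 (Equiv.sumCongr y.2.1 y.2.2)).trans (σ y.1)
  have hlab : ∀ y, IsAdapted (lab y) (p y.1) y.1.1.1.2 := fun y => (hσ y.1).perm y.2.1 y.2.2
  let E : {x : MMSpace n // ∃ σ : MatchedVertex k u ≃ Fin n, IsAdapted σ (p x) x.1.2} ×
      Equiv.Perm (Fin k) × Equiv.Perm (Fin u) → (MatchedVertex k u ≃ Fin n) ×
      (Fin k → Option (Fin n)) × (Fin u → Option (Fin k ⊕ Fin k)) := fun y =>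
    (lab y, fun i => p y.1 (lab y (.inr (.inl i))),
      fun c => (p y.1 (lab y (.inr (.inr c)))).bind fun w => coveredLabel ((lab y).symm w))
  have hE : Function.Injective E := by
    rintro y y' h
    obtain ⟨h1, h23⟩ := Prod.ext_iff.1 h
    obtain ⟨h2, h3⟩ := Prod.ext_iff.1 h23
    have h1 : lab y = lab y' := h1
    have hy := hlab y'
    rw [← h1] at hy
    obtain ⟨hpp, hMM⟩ := (hlab y).ext hy
      (fun i => by simpa [E, ← h1] using congrFun h2 i)
      (fun c => by simpa [E, ← h1] using congrFun h3 c)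
    have hx : y.1 = y'.1 := by
      refine Subtype.ext (Subtype.ext (Prod.ext ?_ hMM))
      ext v w
      rw [hp, hp, hpp]
    have hw : ∀ w, Sum.map y.2.1 (Sum.map y.2.1 y.2.2) w =
        Sum.map y'.2.1 (Sum.map y'.2.1 y'.2.2) w := by
      intro w
      have h4 : σ y.1 (Sum.map y.2.1 (Sum.map y.2.1 y.2.2) w) =
        σ y'.1 (Sum.map y'.2.1 (Sum.map y'.2.1 y'.2.2) w) := DFunLike.congr_fun h1 w
      rw [hx] at h4
      exact (σ y'.1).injective h4
    refine Prod.ext hx (Prod.ext ?_ ?_)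
    · ext1 i
      simpa using hw (.inl i)
    · ext1 c
      simpa using hw (.inr (.inr c))
  have h := Nat.card_le_card_of_injective E hE
  rw [Nat.card_prod, Nat.card_prod, Nat.card_prod, Nat.card_prod] at h
  have hcard : Nat.card (MatchedVertex k u ≃ Fin n) = n.factorial := by
    rw [Nat.card_eq_fintype_card, Fintype.card_equiv e, Fintype.card_congr e, Fintype.card_fin]
  rw [hcard] at h
  simpa [Nat.card_eq_fintype_card, Fintype.card_perm, ← two_mul] using h

lemma mN_le (m : ℕ) :
    (mN (m + 1) : ℝ) ≤ ∑ k ∈ range (m + 2) with 2 * k ≤ m + 1,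
      ((m + 1).factorial : ℝ) * (((m + 1 : ℕ) + 1) ^ k / k.factorial *
        ((2 * k + 1) ^ (m + 1 - 2 * k) / (m + 1 - 2 * k).factorial)) := by
  classical
  have := Fintype.ofFinite (MMSpace (m + 1))
  choose p hp using fun x : MMSpace (m + 1) => exists_orientation x.1.1 x.2.1
  let A : ℕ → Finset (MMSpace (m + 1)) := fun k =>
    {x | ∃ σ : MatchedVertex k (m + 1 - 2 * k) ≃ Fin (m + 1), IsAdapted σ (p x) x.1.2}
  have hA : ∀ k, (#(A k) : ℝ) ≤
      ((m + 1).factorial : ℝ) * (((m + 1 : ℕ) + 1) ^ k / k.factorial *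
        ((2 * k + 1) ^ (m + 1 - 2 * k) / (m + 1 - 2 * k).factorial)) := by
    intro k
    have h := card_isAdapted_mul_le p hp k (m + 1 - 2 * k)
    rw [Nat.card_eq_fintype_card, Fintype.card_subtype] at h
    have h : (#(A k) : ℝ) * (k.factorial * (m + 1 - 2 * k).factorial) ≤
        (m + 1).factorial * (((m + 1 : ℕ) + 1) ^ k * (2 * k + 1) ^ (m + 1 - 2 * k)) := by
      exact_mod_cast h
    rw [div_mul_div_comm, ← mul_div_assoc, le_div_iff₀ (by positivity)]
    exact h
  have hcover : (univ : Finset (MMSpace (m + 1))) ⊆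
      ({k ∈ range (m + 2) | 2 * k ≤ m + 1} : Finset ℕ).biUnion A := by
    intro x _
    obtain ⟨k, u, σ, hσ⟩ := exists_isAdapted x.2.2 (hp x)
    have hc := Fintype.card_congr σ
    simp only [Fintype.card_sum, Fintype.card_fin] at hc
    obtain rfl : u = m + 1 - 2 * k := by omega
    simp only [mem_biUnion, mem_filter, mem_range, A, mem_univ, true_and]
    exact ⟨k, by omega, σ, hσ⟩
  have h1 := (card_le_card hcover).trans card_biUnion_le
  rw [mN, Nat.card_eq_fintype_card]
  calc (Fintype.card (MMSpace (m + 1)) : ℝ)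
      ≤ ∑ k ∈ range (m + 2) with 2 * k ≤ m + 1, (#(A k) : ℝ) := by
        exact_mod_cast h1
    _ ≤ _ := sum_le_sum fun k _ => hA k

end UpperBound

lemma abs_exp_sub_taylor_le {x : ℝ} (hx : |x| ≤ 1) :
    |Real.exp x - ∑ m ∈ Finset.range 12, x ^ m / m.factorial| ≤ 1 / 10 ^ 8 := by
  refine (Real.exp_bound hx (by norm_num)).trans ?_
  have : |x| ^ 12 ≤ 1 := pow_le_one₀ (abs_nonneg x) hx
  norm_num [Nat.factorial] at *
  linarith

lemma exists_saddle : ∃ s : ℝ, 0.400383 < s ∧ s < 0.400385 ∧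
    2 * (s ^ 2 * Real.exp (2 * s)) * (1 + s) = 1 := by
  have hcont : ContinuousOn (fun s : ℝ => 2 * (s ^ 2 * Real.exp (2 * s)) * (1 + s))
      (Set.Icc 0.400383 0.400385) := by fun_prop
  have h := intermediate_value_Ioo (by norm_num) hcont
  obtain ⟨s, hs, hs'⟩ := @h 1 (by
    have h₁ := abs_le.1 (abs_exp_sub_taylor_le (x := 2 * 0.400383) (by norm_num [abs_of_pos]))
    have h₂ := abs_le.1 (abs_exp_sub_taylor_le (x := 2 * 0.400385) (by norm_num [abs_of_pos]))
    norm_num [Finset.sum_range_succ, Nat.factorial] at h₁ h₂ ⊢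
    constructor <;> linarith)
  exact ⟨s, hs.1, hs.2, hs'⟩

lemma exp_div_bounds {s r : ℝ} (h₁ : 0.400383 < s) (h₂ : s < 0.400385)
    (hr : 2 * r * (1 + s) = 1) :
    1.31307 < Real.exp (r - 1) / s ∧ Real.exp (r - 1) / s < 1.31309 := by
  have hs : 0 < s := by linarith
  have hlo : -0.642956 ≤ r - 1 := by nlinarith
  have hhi : r - 1 ≤ -0.642954 := by nlinarith
  have e₁ := abs_le.1 (abs_exp_sub_taylor_le (x := -0.642956) (by norm_num [abs_of_pos]))
  have e₂ := abs_le.1 (abs_exp_sub_taylor_le (x := -0.642954) (by norm_num [abs_of_pos]))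
  norm_num [Finset.sum_range_succ, Nat.factorial] at e₁ e₂
  have l₁ : Real.exp (-(160739 / 250000)) ≤ Real.exp (r - 1) := Real.exp_le_exp.2 (by linarith)
  have l₂ : Real.exp (r - 1) ≤ Real.exp (-(321477 / 500000)) := Real.exp_le_exp.2 (by linarith)
  rw [lt_div_iff₀ hs, div_lt_iff₀ hs]
  constructor <;> norm_num <;> linarith

lemma log_factorial_le {n : ℕ} (hn : n ≠ 0) :
    Real.log n.factorial ≤ n * Real.log n - n + Real.log n + 1 := by
  obtain ⟨m, rfl⟩ := Nat.exists_eq_succ_of_ne_zero hn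
  induction m with
  | zero => simp
  | succ m ih =>
    have ih := ih (by simp)
    have hm : (0 : ℝ) < m + 1 := by positivity
    have key : Real.log (m + 1) ≤ Real.log (m + 1 + 1) - 1 / (m + 1 + 1) := by
      have := Real.log_le_sub_one_of_pos (x := (m + 1) / (m + 1 + 1)) (by positivity)
      rw [Real.log_div (by positivity) (by positivity)] at this
      have e : ((m : ℝ) + 1) / (m + 1 + 1) - 1 = - (1 / (m + 1 + 1)) := by field_simp; ring
      linarith
    have h2 : ((m : ℝ) + 1 + 1) * Real.log (m + 1) ≤
        (m + 1 + 1) * Real.log (m + 1 + 1) - 1 := by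
      have := mul_le_mul_of_nonneg_left key (by positivity : (0 : ℝ) ≤ m + 1 + 1)
      rwa [mul_sub, mul_one_div_cancel (by positivity)] at this
    rw [Nat.factorial_succ]
    push_cast at ih ⊢
    rw [Real.log_mul (by positivity) (by positivity)]
    linarith

lemma le_log_factorial (n : ℕ) : n * Real.log n - n ≤ Real.log n.factorial := by
  rcases n.eq_zero_or_pos with rfl | hn
  · simp
  have h := Real.pow_div_factorial_le_exp (n : ℝ) (by positivity) n
  have hn' : (0 : ℝ) < n := by exact_mod_cast hn
  have := Real.log_le_log (by positivity) h
  rw [Real.log_div (by positivity) (by positivity), Real.log_pow, Real.log_exp] at this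
  linarith

lemma mN_le_exp {s r : ℝ} (hs : 0 < s) (hr : r = s ^ 2 * Real.exp (2 * s)) {n : ℕ} (hn : n ≠ 0) :
    (mN n : ℝ) ≤ (n + 1) * n.factorial * Real.exp (r + s) * (Real.exp r / s) ^ n := by
  obtain ⟨m, rfl⟩ := Nat.exists_eq_succ_of_ne_zero hn
  have hr0 : 0 < r := by rw [hr]; positivity
  refine (mN_le m).trans ?_
  refine (Finset.sum_le_card_nsmul _ _
    ((m + 1).factorial * Real.exp (r + s) * (Real.exp r / s) ^ (m + 1)) fun k hk => ?_).trans ?_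
  · obtain ⟨u, hu⟩ := Nat.exists_eq_add_of_le (Finset.mem_filter.1 hk).2
    rw [mul_assoc]
    refine mul_le_mul_of_nonneg_left ?_ (by positivity)
    rw [hu, Nat.add_sub_cancel_left]
    have h₁ := Real.pow_div_factorial_le_exp (r * ((2 * k + u : ℕ) + 1)) (by positivity) k
    have h₂ := Real.pow_div_factorial_le_exp (s * (2 * k + 1)) (by positivity) u
    have h := mul_le_mul h₁ h₂ (by positivity) (by positivity)
    rw [mul_pow, mul_pow] at h
    have e : Real.exp (r * ((2 * k + u : ℕ) + 1)) * Real.exp (s * (2 * k + 1)) =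
        Real.exp (r + s) * (Real.exp r / s) ^ (2 * k + u) * (r ^ k * s ^ u) := by
      have e₁ : r ^ k = s ^ (2 * k) * Real.exp (2 * s * k) := by
        rw [hr, mul_pow, pow_mul, mul_comm (2 * s), Real.exp_nat_mul]
      rw [e₁, div_pow, ← Real.exp_nat_mul, ← Real.exp_add, pow_add s]
      field_simp
      rw [← Real.exp_add, ← Real.exp_add]
      congr 1
      push_cast
      ring
    rw [e] at h
    refine le_of_mul_le_mul_right (le_trans (le_of_eq ?_) h)
      (by positivity : 0 < r ^ k * s ^ u)
    ring
  · rw [nsmul_eq_mul]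
    have : (({k ∈ Finset.range (m + 2) | 2 * k ≤ m + 1} : Finset ℕ).card : ℝ) ≤ ((m + 1 : ℕ) : ℝ) + 1 := by
      have := Finset.card_filter_le (Finset.range (m + 2)) (fun k => 2 * k ≤ m + 1)
      rw [Finset.card_range] at this
      exact_mod_cast this
    calc _ ≤ (((m + 1 : ℕ) : ℝ) + 1) * _ := mul_le_mul_of_nonneg_right this (by positivity)
      _ = _ := by rw [Nat.succ_eq_add_one]; ring

lemma fN_pos (n : ℕ) : 0 < fN n := by
  have : Nonempty {G : SimpleGraph (Fin n) // G.IsAcyclic} :=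
    ⟨⟨⊥, SimpleGraph.isAcyclic_bot⟩⟩
  exact Nat.card_pos

lemma log_ratio_le {s r : ℝ} (hs : 0 < s) (hr : r = s ^ 2 * Real.exp (2 * s)) {n : ℕ}
    (hn : n ≠ 0) (hm : 0 < mN n) :
    Real.log (mN n / fN n) / n ≤
      (5 * Real.log n + (r + s + 2)) / n + (r - 1 - Real.log s) := by
  have hn1 : (1 : ℝ) ≤ n := by exact_mod_cast Nat.one_le_iff_ne_zero.2 hn
  have hn0 : (0 : ℝ) < n := by linarith
  have hm0 : (0 : ℝ) < mN n := by exact_mod_cast hm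
  have hf0 : (0 : ℝ) < fN n := by exact_mod_cast fN_pos n
  have h₁ := Real.log_le_log hm0 (mN_le_exp hs hr hn)
  have h₂ : (n - 2) * Real.log n ≤ Real.log (fN n) := by
    obtain ⟨m, rfl⟩ := Nat.exists_eq_succ_of_ne_zero hn
    have := Real.log_le_log (by positivity) (le_fN m)
    rw [Real.log_div (by positivity) (by positivity), Real.log_pow] at this
    refine le_trans (le_of_eq ?_) this
    push_cast
    ring
  have h₃ := log_factorial_le hn
  have h₄ : Real.log (n + 1) ≤ Real.log n + 1 := by
    have := Real.log_le_log (by positivity) (by linarith : (n : ℝ) + 1 ≤ 2 * n)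
    rw [Real.log_mul (by norm_num) (by positivity)] at this
    linarith [Real.log_two_lt_d9]
  rw [Real.log_mul (by positivity) (by positivity), Real.log_mul (by positivity) (by positivity),
    Real.log_mul (by positivity) (by positivity), Real.log_exp, Real.log_pow,
    Real.log_div (by positivity) (by positivity), Real.log_exp] at h₁
  have h₅ := Real.log_nonneg hn1
  rw [Real.log_div hm0.ne' hf0.ne', div_le_iff₀ hn0, add_mul, div_mul_cancel₀ _ hn0.ne']
  linarith

lemma le_log_ratio {n k : ℕ} (hk : k ≠ 0) (hkn : 2 * k < n) :
    0 < mN n ∧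
    -((k / n : ℝ) * Real.log (k / n)) + (1 - 2 * (k / n : ℝ)) *
      (Real.log (2 * (k / n)) - Real.log (1 - 2 * (k / n))) - k / n -
      (5 * Real.log n + 3) / n ≤ Real.log (mN n / fN n) / n := by
  obtain ⟨u, hu⟩ := Nat.exists_eq_add_of_le hkn.le
  have hu0 : u ≠ 0 := by omega
  have hk0 : (0 : ℝ) < k := by exact_mod_cast Nat.pos_of_ne_zero hk
  have hu0' : (0 : ℝ) < u := by exact_mod_cast Nat.pos_of_ne_zero hu0
  have huR : (n : ℝ) = 2 * k + u := by rw [hu]; push_cast; ring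
  have hn0 : (0 : ℝ) < n := by rw [huR]; positivity
  have hf0 : (0 : ℝ) < fN n := by exact_mod_cast fN_pos n
  have key : (n.factorial : ℝ) * ((2 * k) ^ u * n ^ k) ≤
      mN n * n ^ 2 * (k.factorial * u.factorial * k) := by
    obtain ⟨j, rfl⟩ := Nat.exists_eq_succ_of_ne_zero hk
    have h : ((n.factorial * (attachments j u).card : ℕ) : ℝ) ≤
        ((mN n * n * ((j + 1).factorial * u.factorial) : ℕ) : ℝ) := by
      exact_mod_cast le_mN hu
    push_cast at h huR
    rw [card_attachments, ← huR, mul_div_assoc', div_le_iff₀ (by positivity)] at h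
    have := mul_le_mul_of_nonneg_right h hn0.le
    rw [pow_succ]
    push_cast
    linarith
  have hm0 : (0 : ℝ) < mN n := by
    by_contra h
    have h0 : (mN n : ℝ) = 0 := le_antisymm (not_lt.1 h) (by positivity)
    rw [h0] at key
    have : 0 < (n.factorial : ℝ) * ((2 * k) ^ u * n ^ k) := by positivity
    linarith
  refine ⟨by exact_mod_cast hm0, ?_⟩
  have h₁ := Real.log_le_log (by positivity) key
  rw [Real.log_mul (by positivity) (by positivity), Real.log_mul (by positivity) (by positivity),
    Real.log_mul (by positivity) (by positivity), Real.log_mul (by positivity) (by positivity),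
    Real.log_mul (by positivity) (by positivity), Real.log_mul (by positivity) (by positivity),
    Real.log_pow, Real.log_pow, Real.log_pow] at h₁
  have h₂ : Real.log (fN n) ≤ n * Real.log n + 1 := by
    have hf : (fN n : ℝ) ≤ (n + 1) ^ n := by
      obtain ⟨m, rfl⟩ := Nat.exists_eq_succ_of_ne_zero (show n ≠ 0 by omega)
      exact_mod_cast fN_le m
    have h := Real.log_le_log hf0 hf
    have h' := Real.log_le_sub_one_of_pos (x := (n + 1) / n) (by positivity)
    rw [Real.log_div (by positivity) (by positivity)] at h'
    have e : ((n : ℝ) + 1) / n - 1 = 1 / n := by field_simp; ring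
    rw [e] at h'
    have h'' := mul_le_mul_of_nonneg_left h' hn0.le
    rw [mul_one_div_cancel hn0.ne', mul_sub] at h''
    rw [Real.log_pow] at h
    linarith
  have h₃ := le_log_factorial n
  have h₄ := log_factorial_le hk
  have h₅ := log_factorial_le hu0
  have h₆ : Real.log k ≤ Real.log n := Real.log_le_log hk0 (by rw [huR]; linarith)
  have h₇ : Real.log u ≤ Real.log n := Real.log_le_log hu0' (by rw [huR]; linarith)
  have hy : 1 - 2 * ((k : ℝ) / n) = u / n := by
    field_simp
    rw [huR]
    ring
  have hx : 2 * ((k : ℝ) / n) = 2 * k / n := by ring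
  rw [hy, hx, Real.log_div hk0.ne' hn0.ne', Real.log_div (by positivity) hn0.ne',
    Real.log_div hu0'.ne' hn0.ne', Real.log_div hm0.ne' hf0.ne', le_div_iff₀ hn0]
  have e : (-((k : ℝ) / n * (Real.log k - Real.log n)) + u / n *
      (Real.log (2 * k) - Real.log n - (Real.log u - Real.log n)) - k / n -
      (5 * Real.log n + 3) / n) * n = -(k * (Real.log k - Real.log n)) +
      u * (Real.log (2 * k) - Real.log u) - k - (5 * Real.log n + 3) := by
    field_simp
    ring
  rw [e]
  push_cast at h₁
  nlinarith

theorem exists_growth_constant : ∃ β : ℝ, 1.31307 < β ∧ β < 1.31309 ∧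
    Tendsto (fun n : ℕ => ((mN n : ℝ) / (fN n : ℝ)) ^ ((n : ℝ)⁻¹)) atTop (𝓝 β) := by
  obtain ⟨s, hs₁, hs₂, hs⟩ := exists_saddle
  obtain ⟨r, hr⟩ : ∃ r, r = s ^ 2 * Real.exp (2 * s) := ⟨_, rfl⟩
  rw [← hr] at hs
  have hs0 : 0 < s := by linarith
  have hr0 : 0 < r := by rw [hr]; positivity
  have hr1 : 1 - 2 * r = 2 * r * s := by linarith
  obtain ⟨hβ₁, hβ₂⟩ := exp_div_bounds hs₁ hs₂ hs
  refine ⟨_, hβ₁, hβ₂, ?_⟩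
  have hlog : Tendsto (fun n : ℕ => Real.log n / n) atTop (𝓝 0) :=
    Real.isLittleO_log_id_atTop.tendsto_div_nhds_zero.comp tendsto_natCast_atTop_atTop
  have hconst (c : ℝ) : Tendsto (fun n : ℕ => (5 * Real.log n + c) / n) atTop (𝓝 0) := by
    have := (hlog.const_mul 5).add (tendsto_const_div_atTop_nhds_zero_nat c)
    simpa [add_div, mul_div_assoc] using this
  have hk : Tendsto (fun n : ℕ => (⌊r * n⌋₊ : ℝ) / n) atTop (𝓝 r) :=
    (tendsto_nat_floor_mul_div_atTop hr0.le).comp tendsto_natCast_atTop_atTop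
  have hgood : ∀ᶠ n : ℕ in atTop, ⌊r * n⌋₊ ≠ 0 ∧ 2 * ⌊r * n⌋₊ < n := by
    filter_upwards [hk.eventually_const_lt hr0, hk.eventually_lt_const
      (show r < 1 / 2 by nlinarith), eventually_gt_atTop 0] with n h₁ h₂ hn
    have hn : (0 : ℝ) < n := by exact_mod_cast hn
    constructor
    · rintro h
      simp [h] at h₁
    · rw [div_lt_iff₀ hn] at h₂
      exact_mod_cast (by linarith : (2 : ℝ) * ⌊r * n⌋₊ < n)
  have hL : Tendsto (fun n : ℕ => Real.log (mN n / fN n) / n) atTop (𝓝 (r - 1 - Real.log s)) := by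
    refine tendsto_of_tendsto_of_tendsto_of_le_of_le' (g := fun n : ℕ => _) (h := fun n : ℕ => _)
      ?_ ?_ (hgood.mono fun n hn => (le_log_ratio hn.1 hn.2).2)
      (hgood.mono fun n hn => log_ratio_le hs0 hr (by omega) (le_log_ratio hn.1 hn.2).1)
    · have hy : Tendsto (fun n : ℕ => 1 - 2 * ((⌊r * n⌋₊ : ℝ) / n)) atTop (𝓝 (1 - 2 * r)) :=
        (hk.const_mul 2).const_sub 1
      have hy0 : 1 - 2 * r ≠ 0 := by rw [hr1]; positivity
      convert (((hk.mul (hk.log hr0.ne')).neg.add (hy.mul (((hk.const_mul 2).log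
        (by positivity)).sub (hy.log hy0)))).sub hk).sub (hconst 3) using 2
      have hlr : Real.log r = 2 * Real.log s + 2 * s := by
        rw [hr, Real.log_mul (by positivity) (by positivity), Real.log_pow, Real.log_exp]
        norm_num
      rw [hr1, Real.log_mul (by positivity) hs0.ne', hlr]
      linear_combination (1 + Real.log s) * hs
    · simpa using (hconst (r + s + 2)).add_const (r - 1 - Real.log s)
  have hβ : Real.exp (r - 1) / s = Real.exp (r - 1 - Real.log s) := by
    rw [Real.exp_sub (r - 1), Real.exp_log hs0]
  rw [hβ]
  refine ((Real.continuous_exp.tendsto _).comp hL).congr' ?_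
  filter_upwards [hgood] with n hn
  have hm := (le_log_ratio hn.1 hn.2).1
  have hf := fN_pos n
  rw [Real.rpow_def_of_pos (by positivity), Function.comp_apply, div_eq_mul_inv]

end ForestMatching

theorem stmt_10 :
    ∃ β : ℝ, 1.31307 < β ∧ β < 1.31309 ∧
      Tendsto (fun n : ℕ => ((mN n : ℝ) / (fN n : ℝ)) ^ ((n : ℝ)⁻¹))
        atTop (nhds β) :=
  ForestMatching.exists_growth_constant
end
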